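/- Let n ≥ 2 and let f : B → ℝⁿ \ {0} be a K-quasiregular mapping in the Miniowitz class (Min) with constants C₀, α, satisfying the multiplicity condition (M) with exponent 0 ≤ a < n−1 and constant C₁. If f ∈ H^p for some 0 < p < ∞, then f belongs to the Bergman space A^{pn/(n−1)}, i.e. ∫_B |f(x)|^{pn/(n−1)} dx < ∞. -/

import Mathlib

open MeasureTheory Metric Set Filter
open scoped ENNReal NNReal Topology Classical

noncomputable section

abbrev Vec (n : ℕ) := EuclideanSpace ℝ (Fin n)

/-- The open unit ball in `ℝⁿ`. -/
def unitBall (n : ℕ) : Set (Vec n) := Metric.ball 0 1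

/-- The unit sphere `S^{n-1}` in `ℝⁿ`. -/
def unitSphere (n : ℕ) : Set (Vec n) := Metric.sphere 0 1

/-- Surface measure on the unit sphere, modelled by `(n-1)`-dimensional
Hausdorff measure restricted to the sphere. -/
def sphMeasure (n : ℕ) : Measure (Vec n) := (μH[(n : ℝ) - 1]).restrict (unitSphere n)

/-- `f` is `K`-quasiregular on the unit ball. -/
def IsQR (n : ℕ) (K : ℝ) (f : Vec n → Vec n) : Prop :=
  ContinuousOn f (unitBall n) ∧
  (∀ x ∈ unitBall n, DifferentiableAt ℝ f x) ∧
  (∀ᵐ x ∂(volume.restrict (unitBall n)),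
    ‖fderiv ℝ f x‖ ^ n ≤ K * (fderiv ℝ f x).det)

/-- The conformal automorphism `T_x` of the unit ball (with `T_0 = id`). -/
def mobiusT (n : ℕ) (x : Vec n) (y : Vec n) : Vec n :=
  if x = 0 then y
  else (‖x‖ ^ 2 * ‖y - (‖x‖ ^ 2)⁻¹ • x‖ ^ 2)⁻¹ •
    ((1 - ‖x‖ ^ 2) • (y - x) - ‖y - x‖ ^ 2 • x)

/-- The Miniowitz class (Min) with constants `C₀, α`. -/
def InMiniowitz (n : ℕ) (C₀ α : ℝ) (f : Vec n → Vec n) : Prop :=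
  ∀ x ∈ unitBall n, ∀ y ∈ unitBall n,
    C₀⁻¹ * ((1 - ‖y‖) / (1 + ‖y‖)) ^ α ≤ ‖f (mobiusT n (-x) y)‖ / ‖f (mobiusT n (-x) 0)‖ ∧
    ‖f (mobiusT n (-x) y)‖ / ‖f (mobiusT n (-x) 0)‖ ≤ C₀ * ((1 + ‖y‖) / (1 - ‖y‖)) ^ α

/-- The multiplicity condition (M) with exponent `a` and constant `C₁`. -/
def MultCond (n : ℕ) (a C₁ : ℝ) (f : Vec n → Vec n) : Prop :=
  ∀ x ∈ unitBall n, ∀ r : ℝ, 0 < r → r < 1 → ∀ y : Vec n,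
    (({z ∈ Metric.ball (0 : Vec n) r | f (mobiusT n (-x) z) = y}).encard : ℝ≥0∞) ≤
      ENNReal.ofReal (C₁ / (1 - r) ^ a)

/-- The non-tangential region `Γ(ω)` with aperture parameter `κ`. -/
def ntRegion (n : ℕ) (κ : ℝ) (ω : Vec n) : Set (Vec n) :=
  {x ∈ unitBall n | ‖x - ω‖ < (1 + κ) * (1 - ‖x‖)}

/-- The non-tangential maximal function `f*`. -/
def ntMax (n : ℕ) (κ : ℝ) (f : Vec n → Vec n) (ω : Vec n) : ℝ≥0∞ :=
  ⨆ x ∈ ntRegion n κ ω, ENNReal.ofReal ‖f x‖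

/-- `f` has the non-tangential limit `L` at `ω`. -/
def HasNTLimit (n : ℕ) (κ : ℝ) (f : Vec n → Vec n) (ω L : Vec n) : Prop :=
  Filter.Tendsto f (𝓝[ntRegion n κ ω] ω) (𝓝 L)

/-- The `p`-th mean of `f` on the sphere of radius `r`. -/
def hardyMean (n : ℕ) (p : ℝ) (f : Vec n → Vec n) (r : ℝ) : ℝ≥0∞ :=
  (sphMeasure n (unitSphere n))⁻¹ *
    ∫⁻ ω, ENNReal.ofReal (‖f (r • ω)‖ ^ p) ∂(sphMeasure n)

/-- The Hardy `H^p` norm of `f` on the unit ball. -/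
def hardyNorm (n : ℕ) (p : ℝ) (f : Vec n → Vec n) : ℝ≥0∞ :=
  (⨆ r ∈ Set.Ioo (0 : ℝ) 1, hardyMean n p f r) ^ (1 / p)

/-- `f` belongs to the Hardy space `H^p`. -/
def MemHp (n : ℕ) (p : ℝ) (f : Vec n → Vec n) : Prop := hardyNorm n p f < ⊤

/-- The `L^p(σ)` norm of a boundary function on the unit sphere. -/
def lpSphere (n : ℕ) (p : ℝ) (g : Vec n → Vec n) : ℝ≥0∞ :=
  (∫⁻ ω, ENNReal.ofReal (‖g ω‖ ^ p) ∂(sphMeasure n)) ^ (1 / p)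

/-- The `L^p(σ)` norm of the non-tangential maximal function `f*`. -/
def ntMaxLp (n : ℕ) (κ p : ℝ) (f : Vec n → Vec n) : ℝ≥0∞ :=
  (∫⁻ ω, (ntMax n κ f ω) ^ p ∂(sphMeasure n)) ^ (1 / p)

/-- `μ` is a Carleson measure on the unit ball with constant `c`. -/
def IsCarleson (n : ℕ) (c : ℝ) (μ : Measure (Vec n)) : Prop :=
  ∀ ω ∈ unitSphere n, ∀ r : ℝ, 0 < r →
    μ (unitBall n ∩ Metric.ball ω r) ≤ ENNReal.ofReal c * ENNReal.ofReal r ^ ((n : ℝ) - 1)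

/-- `μ` is an `α`-Carleson measure on the unit ball with constant `γ`. -/
def IsAlphaCarleson (n : ℕ) (α γ : ℝ) (μ : Measure (Vec n)) : Prop :=
  ∀ ω ∈ unitSphere n, ∀ r : ℝ, 0 < r →
    μ (unitBall n ∩ Metric.ball ω r) ≤
      ENNReal.ofReal γ * ENNReal.ofReal r ^ (α * ((n : ℝ) - 1))

/-- The surface measure on the unit sphere induced by polar coordinates, as a measure on `ℝⁿ`. -/
def polarSphere (n : ℕ) : Measure (Vec n) :=
  (Measure.toSphere (volume : Measure (Vec n))).map Subtype.val

instance (n : ℕ) : IsFiniteMeasure (polarSphere n) := by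
  unfold polarSphere; infer_instance

lemma ae_mem_unitSphere (n : ℕ) : ∀ᵐ ω ∂(polarSphere n), ω ∈ unitSphere n := by
  unfold polarSphere unitSphere
  exact (ae_map_iff measurable_subtype_coe.aemeasurable (p := fun ω => ω ∈ sphere (0 : Vec n) 1)
    isClosed_sphere.measurableSet).2 (Eventually.of_forall fun ω => ω.2)

lemma polarSphere_compl (n : ℕ) : polarSphere n (unitSphere n)ᶜ = 0 :=
  ae_mem_unitSphere n

lemma lintegral_polar {n : ℕ} (hn : 2 ≤ n) {g : Vec n → ℝ≥0∞} (hg : Measurable g) :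
    ∫⁻ y, g y = ∫⁻ ω, (∫⁻ s in Ioi (0 : ℝ), ENNReal.ofReal (s ^ (n - 1)) * g (s • ω))
      ∂(polarSphere n) := by
  have : Nontrivial (Vec n) := by
    have : Nonempty (Fin n) := ⟨⟨0, by omega⟩⟩
    infer_instance
  have hmeas : Measurable fun q : Vec n × ℝ =>
      ENNReal.ofReal (q.2 ^ (n - 1)) * g (q.2 • q.1) :=
    (by fun_prop : Measurable fun q : Vec n × ℝ => ENNReal.ofReal (q.2 ^ (n - 1))).mul
      (hg.comp (by fun_prop))
  have h0 : ∫⁻ y, g y = ∫⁻ x : ({(0 : Vec n)}ᶜ : Set (Vec n)), g x ∂(volume.comap Subtype.val) := by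
    rw [lintegral_subtype_comap (measurableSet_singleton _).compl, restrict_compl_singleton]
  have h1 := (volume : Measure (Vec n)).measurePreserving_homeomorphUnitSphereProd.lintegral_comp_emb
    (homeomorphUnitSphereProd (Vec n)).measurableEmbedding
    (fun q => g ((q.2 : ℝ) • (q.1 : Vec n)))
  have h2 : ∀ x : ({(0 : Vec n)}ᶜ : Set (Vec n)),
      g (((homeomorphUnitSphereProd (Vec n) x).2 : ℝ) •
        ((homeomorphUnitSphereProd (Vec n) x).1 : Vec n)) = g x := by
    intro x
    have hx : ‖(x : Vec n)‖ ≠ 0 := norm_ne_zero_iff.2 x.2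
    simp [smul_smul, hx]
  simp only [h2] at h1
  rw [h0, h1, lintegral_prod]
  rotate_left
  · exact (hg.comp (by fun_prop)).aemeasurable
  unfold polarSphere
  rw [lintegral_map _ measurable_subtype_coe]
  rotate_left
  · exact Measurable.lintegral_prod_right' hmeas
  refine lintegral_congr fun ω => ?_
  have hω : Measurable fun s : ℝ => g (s • (ω : Vec n)) := hg.comp (by fun_prop)
  rw [Measure.volumeIoiPow, lintegral_withDensity_eq_lintegral_mul]
  rotate_left
  · fun_prop
  · exact hω.comp measurable_subtype_coe
  simp only [Pi.mul_apply]
  rw [lintegral_subtype_comap measurableSet_Ioi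
    (fun s : ℝ => ENNReal.ofReal (s ^ (Module.finrank ℝ (Vec n) - 1)) * g (s • (ω : Vec n)))]
  simp

/-- The points of the shell `a ≤ ‖y‖ < b` whose radial projection lies in `E`. -/
def sector {n : ℕ} (a b : ℝ) (E : Set (Vec n)) : Set (Vec n) :=
  {y | ‖y‖ ∈ Ico a b ∧ ‖y‖⁻¹ • y ∈ E}

lemma measurableSet_sector {n : ℕ} (a b : ℝ) {E : Set (Vec n)} (hE : MeasurableSet E) :
    MeasurableSet (sector a b E) :=
  (measurable_norm measurableSet_Ico).inter
    ((by fun_prop : Measurable fun y : Vec n => ‖y‖⁻¹ • y) hE)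

lemma setLIntegral_sector {n : ℕ} (hn : 2 ≤ n) {a b : ℝ} (ha : 0 < a) {E : Set (Vec n)}
    (hE : MeasurableSet E) {g : Vec n → ℝ≥0∞} (hg : Measurable g) :
    ∫⁻ y in sector a b E, g y = ∫⁻ ω in E, (∫⁻ s in Ico a b,
      ENNReal.ofReal (s ^ (n - 1)) * g (s • ω)) ∂(polarSphere n) := by
  rw [← lintegral_indicator (measurableSet_sector a b hE),
    lintegral_polar hn (hg.indicator (measurableSet_sector a b hE)), ← lintegral_indicator hE]
  refine lintegral_congr_ae ?_
  filter_upwards [ae_mem_unitSphere n] with ω hω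
  have hω1 : ‖ω‖ = 1 := by simpa [unitSphere] using hω
  have key : ∀ s ∈ Ioi (0 : ℝ), ENNReal.ofReal (s ^ (n - 1)) * (sector a b E).indicator g (s • ω)
      = (Ico a b).indicator (fun s => E.indicator
        (fun ω => ENNReal.ofReal (s ^ (n - 1)) * g (s • ω)) ω) s := by
    intro s hs
    have hs0 : (0 : ℝ) < s := hs
    have hns : ‖s • ω‖ = s := by rw [norm_smul, hω1, Real.norm_of_nonneg hs0.le, mul_one]
    have hm : s • ω ∈ sector a b E ↔ s ∈ Ico a b ∧ ω ∈ E := by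
      simp only [sector, mem_ofPred_eq, hns, smul_smul, inv_mul_cancel₀ hs0.ne', one_smul]
    by_cases h1 : s ∈ Ico a b <;> by_cases h2 : ω ∈ E <;> simp [indicator, hm, h1, h2]
  rw [setLIntegral_congr_fun measurableSet_Ioi key, setLIntegral_indicator measurableSet_Ico,
    inter_eq_left.2 (show Ico a b ⊆ Ioi 0 from fun s hs => lt_of_lt_of_le ha hs.1)]
  by_cases h2 : ω ∈ E <;> simp [indicator, h2]

lemma volume_sector_le {n : ℕ} (hn : 2 ≤ n) {a b : ℝ} (ha : 0 < a) (hb : b ≤ 1) {E : Set (Vec n)}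
    (hE : MeasurableSet E) :
    volume (sector a b E) ≤ ENNReal.ofReal (b - a) * polarSphere n E := by
  have h := setLIntegral_sector hn (b := b) ha hE (g := fun _ => 1) measurable_const
  rw [setLIntegral_one] at h
  rw [h]
  calc _ ≤ ∫⁻ ω in E, ENNReal.ofReal (b - a) ∂(polarSphere n) := by
        refine lintegral_mono fun ω => ?_
        calc _ ≤ ∫⁻ s in Ico a b, 1 := by
              refine setLIntegral_mono' measurableSet_Ico fun s hs => ?_
              simp only [mul_one, ENNReal.ofReal_le_one]
              exact pow_le_one₀ (ha.le.trans hs.1) (hs.2.le.trans hb)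
          _ = _ := by simp
    _ = _ := by simp

lemma le_volume_sector {n : ℕ} (hn : 2 ≤ n) {a b : ℝ} (ha : 1 / 2 ≤ a) {E : Set (Vec n)}
    (hE : MeasurableSet E) :
    ENNReal.ofReal ((1 / 2) ^ (n - 1)) * ENNReal.ofReal (b - a) * polarSphere n E
      ≤ volume (sector a b E) := by
  have h := setLIntegral_sector hn (b := b) (by linarith : 0 < a) hE (g := fun _ => 1)
    measurable_const
  rw [setLIntegral_one] at h
  rw [h]
  calc _ = ∫⁻ ω in E, ENNReal.ofReal ((1 / 2) ^ (n - 1)) * ENNReal.ofReal (b - a)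
        ∂(polarSphere n) := by simp
    _ ≤ _ := by
        refine lintegral_mono fun ω => ?_
        calc _ = ∫⁻ s in Ico a b, ENNReal.ofReal ((1 / 2) ^ (n - 1)) := by simp
          _ ≤ _ := by
              refine setLIntegral_mono' measurableSet_Ico fun s hs => ?_
              rw [mul_one]
              exact ENNReal.ofReal_le_ofReal (pow_le_pow_left₀ (by norm_num) (ha.trans hs.1) _)

lemma dist_inv_norm_smul_le {n : ℕ} {ω y : Vec n} (hω : ‖ω‖ = 1) (hy : y ≠ 0) :
    ‖‖y‖⁻¹ • y - ω‖ ≤ 2 * ‖y - ω‖ := by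
  have h1 : ‖‖y‖⁻¹ • y - y‖ ≤ ‖y - ω‖ := by
    have hy' : ‖y‖ ≠ 0 := norm_ne_zero_iff.2 hy
    have : ‖y‖⁻¹ • y - y = (‖y‖⁻¹ * (1 - ‖y‖)) • y := by
      rw [mul_sub, inv_mul_cancel₀ hy', sub_smul, mul_one, one_smul]
    rw [this, norm_smul, norm_mul, norm_inv, norm_norm, mul_right_comm, inv_mul_cancel₀ hy',
      one_mul, ← hω, norm_sub_rev y]
    exact abs_norm_sub_norm_le _ _
  calc _ = ‖(‖y‖⁻¹ • y - y) + (y - ω)‖ := by rw [sub_add_sub_cancel]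
    _ ≤ _ := (norm_add_le _ _).trans (by linarith)

lemma exists_polarSphere_closedBall_le {n : ℕ} (hn : 2 ≤ n) :
    ∃ C : ℝ, 0 < C ∧ ∀ ω ∈ unitSphere n, ∀ d : ℝ, 0 < d → d ≤ 1 / 2 →
      polarSphere n (closedBall ω d) ≤ ENNReal.ofReal (C * d ^ (n - 1)) := by
  set v : ℝ := (volume : Measure (Vec n)).real (ball 0 1) with hv
  have hvpos : 0 < v := ENNReal.toReal_pos (measure_ball_pos _ _ one_pos).ne' measure_ball_lt_top.ne
  refine ⟨2 ^ (n - 1) * 3 ^ n * v, by positivity, fun ω hω d hd hd2 => ?_⟩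
  have hω1 : ‖ω‖ = 1 := by simpa [unitSphere] using hω
  have h1 := le_volume_sector hn (a := 1 - d) (b := 1) (by linarith)
    (isClosed_closedBall (x := ω) (ε := d)).measurableSet
  have h2 : sector (1 - d) 1 (closedBall ω d) ⊆ ball ω (3 * d) := by
    rintro y ⟨⟨hy1, hy2⟩, hy3⟩
    rw [mem_closedBall, dist_eq_norm] at hy3
    rw [mem_ball, dist_eq_norm]
    have hy0 : ‖y‖ ≠ 0 := by linarith
    have : y - ‖y‖⁻¹ • y = (-(‖y‖⁻¹ * (1 - ‖y‖))) • y := by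
      rw [mul_sub, inv_mul_cancel₀ hy0, neg_sub, sub_smul, mul_one, one_smul]
    have h3 : ‖y - ‖y‖⁻¹ • y‖ ≤ d := by
      rw [this, norm_smul, norm_neg, norm_mul, norm_inv, norm_norm, mul_right_comm,
        inv_mul_cancel₀ hy0, one_mul, Real.norm_of_nonneg (by linarith)]
      linarith
    calc _ = ‖(y - ‖y‖⁻¹ • y) + (‖y‖⁻¹ • y - ω)‖ := by rw [sub_add_sub_cancel]
      _ ≤ _ := norm_add_le _ _
      _ < _ := by linarith
  have h3 := h1.trans (measure_mono h2)
  have h4 : (volume : Measure (Vec n)) (ball ω (3 * d)) = ENNReal.ofReal ((3 * d) ^ n * v) := by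
    rw [Measure.addHaar_ball_of_pos _ _ (by positivity), hv, measureReal_def,
      ENNReal.ofReal_mul (by positivity), ENNReal.ofReal_toReal measure_ball_lt_top.ne]
    simp
  rw [h4, sub_sub_cancel, ← ENNReal.ofReal_mul (by positivity)] at h3
  have h5 : polarSphere n (closedBall ω d)
      = ENNReal.ofReal ((polarSphere n).real (closedBall ω d)) := by
    rw [measureReal_def, ENNReal.ofReal_toReal (measure_ne_top _ _)]
  rw [h5] at h3 ⊢
  rw [← ENNReal.ofReal_mul (by positivity), ENNReal.ofReal_le_ofReal_iff (by positivity)] at h3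
  refine ENNReal.ofReal_le_ofReal ?_
  obtain ⟨m, rfl⟩ : ∃ m, n = m + 1 := ⟨n - 1, by omega⟩
  simp only [Nat.add_sub_cancel] at h3 ⊢
  have e : (1 / 2 : ℝ) ^ m * 2 ^ m = 1 := by rw [← mul_pow]; norm_num
  generalize (polarSphere (m + 1)).real (closedBall ω d) = q at *
  have : d * q ≤ d * (2 ^ m * 3 ^ (m + 1) * v * d ^ m) := by
    calc d * q = 2 ^ m * ((1 / 2) ^ m * d * q) := by linear_combination (- d * q) * e
      _ ≤ 2 ^ m * ((3 * d) ^ (m + 1) * v) := by gcongr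
      _ = _ := by rw [mul_pow]; ring
  exact le_of_mul_le_mul_left this hd

lemma exists_le_polarSphere_ball {n : ℕ} (hn : 2 ≤ n) :
    ∃ c : ℝ, 0 < c ∧ ∀ ω ∈ unitSphere n, ∀ d : ℝ, 0 < d → d ≤ 1 / 2 →
      ENNReal.ofReal (c * d ^ (n - 1)) ≤ polarSphere n (ball ω d) := by
  set v : ℝ := (volume : Measure (Vec n)).real (ball 0 1) with hv
  have hvpos : 0 < v := ENNReal.toReal_pos (measure_ball_pos _ _ one_pos).ne' measure_ball_lt_top.ne
  refine ⟨(1 / 4) ^ n * v, by positivity, fun ω hω d hd hd2 => ?_⟩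
  have hω1 : ‖ω‖ = 1 := by simpa [unitSphere] using hω
  have h1 := volume_sector_le hn (a := 1 - d / 2) (b := 1) (by linarith) le_rfl
    (isOpen_ball (x := ω) (ε := d)).measurableSet
  have h2 : ball ((1 - d / 4) • ω) (d / 4) ⊆ sector (1 - d / 2) 1 (ball ω d) := by
    intro y hy
    rw [mem_ball, dist_eq_norm] at hy
    have hn1 : ‖(1 - d / 4) • ω‖ = 1 - d / 4 := by
      rw [norm_smul, hω1, Real.norm_of_nonneg (by linarith), mul_one]
    have h5 := abs_norm_sub_norm_le y ((1 - d / 4) • ω)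
    rw [hn1, abs_le] at h5
    have h6 : ‖y - ω‖ < d / 2 := by
      calc _ = ‖(y - (1 - d / 4) • ω) + (-(d / 4)) • ω‖ := by
            congr 1
            module
        _ ≤ _ := norm_add_le _ _
        _ < d / 4 + d / 4 := by
            rw [norm_smul, hω1, norm_neg, Real.norm_of_nonneg (by linarith)]; linarith
        _ = _ := by ring
    have hy0 : y ≠ 0 := norm_pos_iff.1 (by linarith)
    refine ⟨⟨by linarith, by linarith⟩, ?_⟩
    rw [mem_ball, dist_eq_norm]
    linarith [dist_inv_norm_smul_le hω1 hy0]
  have h3 := (measure_mono h2).trans h1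
  have h4 : (volume : Measure (Vec n)) (ball ((1 - d / 4) • ω) (d / 4))
      = ENNReal.ofReal ((d / 4) ^ n * v) := by
    rw [Measure.addHaar_ball_of_pos _ _ (by positivity), hv, measureReal_def,
      ENNReal.ofReal_mul (by positivity), ENNReal.ofReal_toReal measure_ball_lt_top.ne]
    simp
  have h5 : polarSphere n (ball ω d)
      = ENNReal.ofReal ((polarSphere n).real (ball ω d)) := by
    rw [measureReal_def, ENNReal.ofReal_toReal (measure_ne_top _ _)]
  rw [h5] at h3 ⊢
  rw [h4, sub_sub_cancel, ← ENNReal.ofReal_mul (by positivity),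
    ENNReal.ofReal_le_ofReal_iff (by positivity)] at h3
  refine ENNReal.ofReal_le_ofReal ?_
  obtain ⟨m, rfl⟩ : ∃ m, n = m + 1 := ⟨n - 1, by omega⟩
  simp only [Nat.add_sub_cancel]
  have hq : 0 ≤ (polarSphere (m + 1)).real (ball ω d) := by positivity
  generalize (polarSphere (m + 1)).real (ball ω d) = q at *
  have : d * ((1 / 4) ^ (m + 1) * v * d ^ m) ≤ d * q := by
    calc _ = (d / 4) ^ (m + 1) * v := by rw [div_pow, div_pow]; ring
      _ ≤ d / 2 * q := h3
      _ ≤ _ := by nlinarith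
  exact le_of_mul_le_mul_left this hd

lemma exists_polarSphere_le_sphMeasure {n : ℕ} (hn : 2 ≤ n) :
    ∃ C : ℝ≥0∞, C ≠ ⊤ ∧ polarSphere n ≤ C • sphMeasure n := by
  obtain ⟨C, hC, hcap⟩ := exists_polarSphere_closedBall_le hn
  have hC0 : ENNReal.ofReal C ≠ 0 := by simpa using hC
  refine ⟨ENNReal.ofReal C, ENNReal.ofReal_ne_top, ?_⟩
  have hle : (ENNReal.ofReal C)⁻¹ • polarSphere n ≤ μH[(n : ℝ) - 1] := by
    refine Measure.le_hausdorffMeasure _ _ (ENNReal.ofReal (1 / 2)) (by norm_num) fun s hs => ?_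
    have hs' : ediam s ≠ ⊤ := ne_top_of_le_ne_top ENNReal.ofReal_ne_top hs
    rw [Measure.smul_apply, smul_eq_mul]
    refine (ENNReal.inv_mul_le_iff hC0 ENNReal.ofReal_ne_top).2 ?_
    rcases (s ∩ unitSphere n).eq_empty_or_nonempty with he | ⟨ω, hωs, hω⟩
    · have : s ⊆ (unitSphere n)ᶜ := fun x hx hx' => by
        have : x ∈ s ∩ unitSphere n := ⟨hx, hx'⟩
        simp [he] at this
      rw [measure_mono_null this (polarSphere_compl n)]
      exact zero_le
    · set d := (ediam s).toReal with hd
      have hd2 : d ≤ 1 / 2 := by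
        rw [hd]
        exact ENNReal.toReal_le_of_le_ofReal (by norm_num) hs
      have hsub : ∀ e, d ≤ e → s ⊆ closedBall ω e := fun e he x hx => by
        rw [mem_closedBall]
        refine le_trans ?_ he
        rw [hd, dist_edist]
        exact ENNReal.toReal_mono hs' (edist_le_ediam_of_mem hx hωs)
      have hpow : ediam s ^ ((n : ℝ) - 1) = ENNReal.ofReal (d ^ (n - 1)) := by
        rw [← ENNReal.ofReal_toReal hs', ← hd, ENNReal.ofReal_pow ENNReal.toReal_nonneg,
          ← ENNReal.rpow_natCast]
        congr 1
        push_cast [show 1 ≤ n by omega]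
        rfl
      rw [hpow, ← ENNReal.ofReal_mul hC.le]
      rcases (show 0 ≤ d from ENNReal.toReal_nonneg).eq_or_lt with h0 | hpos
      · have ht : Tendsto (fun e : ℝ => ENNReal.ofReal (C * e ^ (n - 1))) (𝓝[>] 0)
            (𝓝 (ENNReal.ofReal (C * d ^ (n - 1)))) := by
          refine tendsto_nhdsWithin_of_tendsto_nhds ?_
          rw [← h0]
          exact (ENNReal.continuous_ofReal.comp
            (by fun_prop : Continuous fun e : ℝ => C * e ^ (n - 1))).tendsto 0
        refine ge_of_tendsto ht ?_
        filter_upwards [Ioc_mem_nhdsGT (show (0 : ℝ) < 1 / 2 by norm_num)] with e he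
        exact (measure_mono (hsub e (by rw [← h0]; exact he.1.le))).trans
          (hcap ω hω e he.1 he.2)
      · exact (measure_mono (hsub d le_rfl)).trans (hcap ω hω d hpos hd2)
  refine Measure.le_iff.2 fun s hs => ?_
  have h1 : polarSphere n s = polarSphere n (s ∩ unitSphere n) := by
    refine le_antisymm ?_ (measure_mono inter_subset_left)
    calc _ ≤ polarSphere n ((s ∩ unitSphere n) ∪ (unitSphere n)ᶜ) := measure_mono fun x hx => by
            by_cases h : x ∈ unitSphere n
            · exact Or.inl ⟨hx, h⟩
            · exact Or.inr h
      _ ≤ _ := measure_union_le _ _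
      _ = _ := by rw [polarSphere_compl, add_zero]
  rw [h1, Measure.smul_apply, smul_eq_mul, sphMeasure, Measure.restrict_apply hs]
  have h2 := hle (s ∩ unitSphere n)
  rw [Measure.smul_apply, smul_eq_mul] at h2
  exact (ENNReal.inv_mul_le_iff hC0 ENNReal.ofReal_ne_top).1 h2

lemma norm_inv_norm_smul_sub_le {n : ℕ} {v w : Vec n} (hv : 1 ≤ ‖v‖) (hw : 1 ≤ ‖w‖) :
    ‖‖v‖⁻¹ • v - ‖w‖⁻¹ • w‖ ≤ 2 * ‖v - w‖ := by
  have hv0 : ‖v‖ ≠ 0 := by linarith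
  have hw0 : ‖w‖ ≠ 0 := by linarith
  have h := dist_inv_norm_smul_le (ω := ‖w‖⁻¹ • w) (y := ‖w‖⁻¹ • v)
    (by rw [norm_smul, norm_inv, norm_norm, inv_mul_cancel₀ hw0])
    (smul_ne_zero (inv_ne_zero hw0) (norm_ne_zero_iff.1 hv0))
  rw [← smul_sub, norm_smul, norm_smul, norm_inv, norm_norm, smul_smul] at h
  have e : (‖w‖⁻¹ * ‖v‖)⁻¹ * ‖w‖⁻¹ = ‖v‖⁻¹ := by field_simp
  rw [e] at h
  refine h.trans ?_
  have : ‖w‖⁻¹ ≤ 1 := inv_le_one_of_one_le₀ hw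
  nlinarith [norm_nonneg (v - w)]

lemma sphMeasure_unitSphere_lt_top {n : ℕ} (hn : 2 ≤ n) : sphMeasure n (unitSphere n) < ⊤ := by
  obtain ⟨m, rfl⟩ : ∃ m, n = m + 1 := ⟨n - 1, by omega⟩
  rw [sphMeasure, Measure.restrict_apply_self]
  have hd : ((m + 1 : ℕ) : ℝ) - 1 = (m : ℝ) := by push_cast; ring
  rw [hd]
  set Q : Set (Fin m → ℝ) := Icc (fun _ => -1) (fun _ => 1) with hQ
  let ι : Fin (m + 1) × Bool → (Fin m → ℝ) → Vec (m + 1) := fun q z =>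
    WithLp.toLp 2 (Fin.insertNth q.1 (if q.2 then (1 : ℝ) else -1) z)
  have hι : ∀ q, ∀ z, 1 ≤ ‖ι q z‖ := by
    rintro ⟨i, b⟩ z
    have := PiLp.norm_apply_le (ι (i, b) z) i
    simp only [ι, Fin.insertNth_apply_same] at this
    refine le_trans ?_ this
    cases b <;> simp
  have hcov : unitSphere (m + 1) ⊆ ⋃ q, (fun z => ‖ι q z‖⁻¹ • ι q z) '' Q := by
    intro ω hω
    have hω1 : ‖ω‖ = 1 := by simpa [unitSphere] using hω
    obtain ⟨i, -, hi⟩ := Finset.exists_max_image (Finset.univ : Finset (Fin (m + 1)))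
      (fun i => |ω i|) Finset.univ_nonempty
    have hi0 : ω i ≠ 0 := by
      intro h
      have : ω = 0 := by
        ext j
        have := hi j (Finset.mem_univ j)
        rw [h, abs_zero] at this
        simpa using abs_nonpos_iff.1 this
      simp [this] at hω1
    have hpos : 0 < |ω i| := abs_pos.2 hi0
    refine mem_iUnion.2 ⟨(i, decide (0 < ω i)), fun j => ω (i.succAbove j) / |ω i|, ?_, ?_⟩
    · refine ⟨fun j => ?_, fun j => ?_⟩
      all_goals
        have h1 := hi (i.succAbove j) (Finset.mem_univ _)
        have h2 := abs_le.1 h1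
        simp only
      · rw [le_div_iff₀ hpos]; linarith
      · rw [div_le_iff₀ hpos]; linarith
    · have : ι (i, decide (0 < ω i)) (fun j => ω (i.succAbove j) / |ω i|) = |ω i|⁻¹ • ω := by
        ext j
        simp only [ι, PiLp.smul_apply, smul_eq_mul]
        rcases Fin.eq_self_or_eq_succAbove i j with rfl | ⟨k, rfl⟩
        · rw [Fin.insertNth_apply_same]
          rcases lt_or_gt_of_ne hi0 with h | h
          · simp [not_lt.2 h.le, abs_of_neg h, hi0]
          · simp [h, abs_of_pos h, hi0]
        · rw [Fin.insertNth_apply_succAbove]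
          field_simp
      simp only [this]
      rw [norm_smul, hω1, smul_smul, norm_inv, norm_abs_eq_norm, mul_one, inv_inv,
        Real.norm_eq_abs, mul_inv_cancel₀ hpos.ne', one_smul]
  refine (measure_mono hcov).trans_lt ((measure_iUnion_le _).trans_lt ?_)
  rw [tsum_fintype]
  refine ENNReal.sum_lt_top.2 fun q _ => ?_
  obtain ⟨L, hL⟩ : ∃ L : ℝ≥0, LipschitzWith L (fun z => ‖ι q z‖⁻¹ • ι q z) := by
    have h1 : LipschitzWith 1 fun z : Fin m → ℝ =>
        (Fin.insertNth q.1 (if q.2 then (1 : ℝ) else -1) z : Fin (m + 1) → ℝ) := by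
      refine LipschitzWith.of_dist_le_mul fun z w => ?_
      rw [NNReal.coe_one, one_mul, dist_pi_le_iff dist_nonneg]
      intro j
      rcases Fin.eq_self_or_eq_succAbove q.1 j with rfl | ⟨k, rfl⟩
      · simp
      · simpa using dist_le_pi_dist z w k
    have h2 := (PiLp.lipschitzWith_toLp 2 (fun _ : Fin (m + 1) => ℝ)).comp h1
    obtain ⟨L, h2⟩ : ∃ L, LipschitzWith L (ι q) := ⟨_, h2⟩
    refine ⟨2 * L, LipschitzWith.of_dist_le_mul fun z w => ?_⟩
    rw [dist_eq_norm]
    refine (norm_inv_norm_smul_sub_le (hι q z) (hι q w)).trans ?_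
    have := h2.dist_le_mul z w
    rw [dist_eq_norm] at this
    push_cast
    linarith
  refine (hL.hausdorffMeasure_image_le (Nat.cast_nonneg m) Q).trans_lt ?_
  refine ENNReal.mul_lt_top (ENNReal.rpow_lt_top_of_nonneg (Nat.cast_nonneg m)
    ENNReal.coe_ne_top) ?_
  have h3 := hausdorffMeasure_pi_real (ι := Fin m)
  rw [Fintype.card_fin] at h3
  rw [h3]
  exact isCompact_Icc.measure_lt_top

lemma exists_lintegral_polarSphere_le_of_memHp {n : ℕ} (hn : 2 ≤ n) {p : ℝ} (hp : 0 < p)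
    {f : Vec n → Vec n} (hf : MemHp n p f) :
    ∃ M : ℝ, 0 < M ∧ ∀ r ∈ Ioo (0 : ℝ) 1,
      ∫⁻ ω, ENNReal.ofReal (‖f (r • ω)‖ ^ p) ∂(polarSphere n) ≤ ENNReal.ofReal M := by
  obtain ⟨C, hC, hle⟩ := exists_polarSphere_le_sphMeasure hn
  have hfin := sphMeasure_unitSphere_lt_top hn
  have hsup : (⨆ r ∈ Set.Ioo (0 : ℝ) 1, hardyMean n p f r) < ⊤ := by
    unfold MemHp hardyNorm at hf
    by_contra h
    rw [not_lt, top_le_iff] at h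
    rw [h, ENNReal.top_rpow_of_pos (by positivity)] at hf
    exact lt_irrefl _ hf
  set A := ⨆ r ∈ Set.Ioo (0 : ℝ) 1, hardyMean n p f r
  have hB : C * (sphMeasure n (unitSphere n) * A) ≠ ⊤ :=
    ENNReal.mul_ne_top hC (ENNReal.mul_ne_top hfin.ne hsup.ne)
  refine ⟨(C * (sphMeasure n (unitSphere n) * A)).toReal + 1, by positivity, fun r hr => ?_⟩
  have h1 : ∫⁻ ω, ENNReal.ofReal (‖f (r • ω)‖ ^ p) ∂(sphMeasure n)
      ≤ sphMeasure n (unitSphere n) * A := by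
    rcases eq_or_ne (sphMeasure n (unitSphere n)) 0 with h0 | h0
    · have : sphMeasure n = 0 := by
        rw [sphMeasure, Measure.restrict_apply_self] at h0
        rw [sphMeasure, Measure.restrict_eq_zero.2 h0]
      rw [this]
      simp
    · have h2 : hardyMean n p f r ≤ A := le_iSup₂ (f := fun r _ => hardyMean n p f r) r hr
      exact (ENNReal.inv_mul_le_iff h0 hfin.ne).1 h2
  calc _ ≤ ∫⁻ ω, ENNReal.ofReal (‖f (r • ω)‖ ^ p) ∂(C • sphMeasure n) :=
        lintegral_mono' hle le_rfl
    _ = C * ∫⁻ ω, ENNReal.ofReal (‖f (r • ω)‖ ^ p) ∂(sphMeasure n) := lintegral_smul_measure _ _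
    _ ≤ C * (sphMeasure n (unitSphere n) * A) := by gcongr
    _ = ENNReal.ofReal ((C * (sphMeasure n (unitSphere n) * A)).toReal) :=
        (ENNReal.ofReal_toReal hB).symm
    _ ≤ _ := ENNReal.ofReal_le_ofReal (by linarith)

lemma mobiusT_neg_zero {n : ℕ} (x : Vec n) : mobiusT n (-x) 0 = x := by
  unfold mobiusT
  by_cases hx : x = 0
  · simp [hx]
  · have hx' : ‖x‖ ≠ 0 := norm_ne_zero_iff.2 hx
    have h1 : ‖x‖ ^ 2 * ‖(0 : Vec n) - (‖x‖ ^ 2)⁻¹ • (-x)‖ ^ 2 = 1 := by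
      rw [zero_sub, smul_neg, neg_neg, norm_smul, norm_inv, norm_pow, norm_norm]
      field_simp
    rw [if_neg (neg_ne_zero.2 hx), norm_neg, h1]
    simp only [inv_one, one_smul, smul_neg, sub_neg_eq_add, zero_add]
    rw [← add_smul]
    simp

lemma mobiusT_eq {n : ℕ} {x : Vec n} (hx : x ≠ 0) (y : Vec n) :
    mobiusT n x y = (1 - 2 * inner ℝ x y + ‖x‖ ^ 2 * ‖y‖ ^ 2)⁻¹ •
      ((1 - ‖x‖ ^ 2) • y - (1 - 2 * inner ℝ x y + ‖y‖ ^ 2) • x) := by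
  have hx' : ‖x‖ ≠ 0 := norm_ne_zero_iff.2 hx
  unfold mobiusT
  rw [if_neg hx]
  have h1 : ‖x‖ ^ 2 * ‖y - (‖x‖ ^ 2)⁻¹ • x‖ ^ 2
      = 1 - 2 * inner ℝ x y + ‖x‖ ^ 2 * ‖y‖ ^ 2 := by
    rw [norm_sub_sq_real, norm_smul, norm_inv, norm_pow, norm_norm, inner_smul_right,
      real_inner_comm]
    field_simp
    ring
  have h2 : ‖y - x‖ ^ 2 = ‖y‖ ^ 2 - 2 * inner ℝ x y + ‖x‖ ^ 2 := by
    rw [norm_sub_sq_real, real_inner_comm]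
  rw [h1, h2]
  module

/-- The square `1 - 2 ⟨x, y⟩ + |x|² |y|²` of the Ahlfors bracket, up to the factor defining `T_x`. -/
lemma ahlfors_bracket_eq {n : ℕ} (x y : Vec n) :
    1 - 2 * inner ℝ x y + ‖x‖ ^ 2 * ‖y‖ ^ 2
      = ‖y - x‖ ^ 2 + (1 - ‖x‖ ^ 2) * (1 - ‖y‖ ^ 2) := by
  rw [norm_sub_sq_real, real_inner_comm]
  ring

lemma ahlfors_bracket_pos {n : ℕ} {x y : Vec n} (hx : ‖x‖ < 1) (hy : ‖y‖ < 1) :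
    0 < 1 - 2 * inner ℝ x y + ‖x‖ ^ 2 * ‖y‖ ^ 2 := by
  rw [ahlfors_bracket_eq]
  have h1 : 0 < 1 - ‖x‖ ^ 2 := by nlinarith [norm_nonneg x]
  have h2 : 0 < 1 - ‖y‖ ^ 2 := by nlinarith [norm_nonneg y]
  positivity

lemma norm_sq_smul_sub_smul {n : ℕ} (a b : ℝ) (x y : Vec n) :
    ‖a • y - b • x‖ ^ 2 = a ^ 2 * ‖y‖ ^ 2 - 2 * a * b * inner ℝ x y + b ^ 2 * ‖x‖ ^ 2 := by
  rw [norm_sub_sq_real, norm_smul, norm_smul, inner_smul_left, inner_smul_right, mul_pow, mul_pow,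
    Real.norm_eq_abs, Real.norm_eq_abs, sq_abs, sq_abs, real_inner_comm]
  simp only [conj_trivial]
  ring

lemma one_sub_norm_mobiusT_sq {n : ℕ} {x y : Vec n} (hx0 : x ≠ 0) (hx : ‖x‖ < 1) (hy : ‖y‖ < 1) :
    1 - ‖mobiusT n x y‖ ^ 2 = (1 - ‖x‖ ^ 2) * (1 - ‖y‖ ^ 2) /
      (1 - 2 * inner ℝ x y + ‖x‖ ^ 2 * ‖y‖ ^ 2) := by
  have hD := ahlfors_bracket_pos hx hy
  rw [mobiusT_eq hx0, norm_smul, mul_pow, norm_sq_smul_sub_smul, norm_inv, Real.norm_eq_abs,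
    inv_pow, sq_abs]
  generalize (inner ℝ x y : ℝ) = p at *
  field_simp
  ring

lemma mobiusT_neg_mobiusT {n : ℕ} {x y : Vec n} (hx0 : x ≠ 0) (hx : ‖x‖ < 1) (hy : ‖y‖ < 1) :
    mobiusT n (-x) (mobiusT n x y) = y := by
  have hD := ahlfors_bracket_pos hx hy
  have hA : 0 < 1 - ‖x‖ ^ 2 := by nlinarith [norm_nonneg x]
  have h1 := one_sub_norm_mobiusT_sq hx0 hx hy
  rw [mobiusT_eq (neg_ne_zero.2 hx0)]
  have h2 : (inner ℝ (-x) (mobiusT n x y) : ℝ) =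
      -(((1 - ‖x‖ ^ 2) * inner ℝ x y - (1 - 2 * inner ℝ x y + ‖y‖ ^ 2) * ‖x‖ ^ 2) /
        (1 - 2 * inner ℝ x y + ‖x‖ ^ 2 * ‖y‖ ^ 2)) := by
    rw [inner_neg_left, mobiusT_eq hx0, inner_smul_right, inner_sub_right, inner_smul_right,
      inner_smul_right, real_inner_self_eq_norm_sq]
    field_simp
  have h3 : ‖mobiusT n x y‖ ^ 2 = 1 - (1 - ‖x‖ ^ 2) * (1 - ‖y‖ ^ 2) /
      (1 - 2 * inner ℝ x y + ‖x‖ ^ 2 * ‖y‖ ^ 2) := by linarith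
  rw [h2, h3, norm_neg, mobiusT_eq hx0]
  generalize (inner ℝ x y : ℝ) = p at *
  generalize ‖x‖ ^ 2 = X at *
  generalize ‖y‖ ^ 2 = Y at *
  have e1 : 1 - 2 * -(((1 - X) * p - (1 - 2 * p + Y) * X) / (1 - 2 * p + X * Y)) +
      X * (1 - (1 - X) * (1 - Y) / (1 - 2 * p + X * Y)) = (1 - X) ^ 2 / (1 - 2 * p + X * Y) := by
    field_simp
    ring
  have e2 : 1 - 2 * -(((1 - X) * p - (1 - 2 * p + Y) * X) / (1 - 2 * p + X * Y)) +
      (1 - (1 - X) * (1 - Y) / (1 - 2 * p + X * Y)) =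
      (1 - X) * (1 - 2 * p + Y) / (1 - 2 * p + X * Y) := by
    field_simp
    ring
  rw [e1, e2]
  match_scalars
  · field_simp
  · field_simp
    ring

/-- If `y` lies at a distance comparable to `1 - |x|` from `x`, then `T_x y` stays away from the
sphere by a quantity comparable to the ratio of the distances of `y` and `x` to the sphere. -/
lemma norm_mobiusT_lt {n : ℕ} {x y : Vec n} (hx0 : x ≠ 0) (hx : ‖x‖ < 1)
    (hy : ‖y‖ < 1) (hxy : ‖x‖ ≤ ‖y‖) (hd : ‖y - x‖ ≤ 2 * (1 - ‖x‖)) {q : ℝ}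
    (hq : q * (1 - ‖x‖) ≤ 1 - ‖y‖) : ‖mobiusT n x y‖ < 1 - q / 20 := by
  have hD := ahlfors_bracket_pos hx hy
  have h1 := one_sub_norm_mobiusT_sq hx0 hx hy
  have hD8 : 1 - 2 * inner ℝ x y + ‖x‖ ^ 2 * ‖y‖ ^ 2 ≤ 8 * (1 - ‖x‖) ^ 2 := by
    rw [ahlfors_bracket_eq]
    have h2 : ‖y - x‖ ^ 2 ≤ (2 * (1 - ‖x‖)) ^ 2 := pow_le_pow_left₀ (norm_nonneg _) hd 2
    have h3 : 1 - ‖x‖ ^ 2 ≤ 2 * (1 - ‖x‖) := by nlinarith [norm_nonneg x]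
    have h4 : 1 - ‖y‖ ^ 2 ≤ 2 * (1 - ‖x‖) := by nlinarith [norm_nonneg y]
    have h5 : 0 ≤ 1 - ‖y‖ ^ 2 := by nlinarith [norm_nonneg y]
    nlinarith [mul_le_mul h3 h4 h5 (by linarith)]
  have hpos : 0 < 1 - ‖mobiusT n x y‖ ^ 2 := by
    rw [h1]
    have h3 : 0 < 1 - ‖x‖ ^ 2 := by nlinarith [norm_nonneg x]
    have h5 : 0 < 1 - ‖y‖ ^ 2 := by nlinarith [norm_nonneg y]
    positivity
  have hT1 : ‖mobiusT n x y‖ < 1 := by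
    have := norm_nonneg (mobiusT n x y)
    nlinarith
  rcases le_or_gt q 0 with hq0 | hq0
  · linarith
  have h6 : q / 8 ≤ 1 - ‖mobiusT n x y‖ ^ 2 := by
    rw [h1, le_div_iff₀ hD]
    have h3 : 1 - ‖x‖ ≤ 1 - ‖x‖ ^ 2 := by nlinarith [norm_nonneg x]
    have h4 : 1 - ‖y‖ ≤ 1 - ‖y‖ ^ 2 := by nlinarith [norm_nonneg y]
    calc _ ≤ q / 8 * (8 * (1 - ‖x‖) ^ 2) := by gcongr
      _ = (1 - ‖x‖) * (q * (1 - ‖x‖)) := by ring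
      _ ≤ (1 - ‖x‖) * (1 - ‖y‖) := by gcongr
      _ ≤ _ := mul_le_mul h3 h4 (by linarith) (by linarith)
  nlinarith [norm_nonneg (mobiusT n x y)]

/-- Points of a set mapped by `T_x` into a smaller ball inherit the multiplicity bound. -/
lemma MultCond.encard_le {n : ℕ} {a C₁ : ℝ} {f : Vec n → Vec n} (hM : MultCond n a C₁ f)
    {x : Vec n} (hx0 : x ≠ 0) (hx : ‖x‖ < 1) {r : ℝ} (hr0 : 0 < r) (hr1 : r < 1)
    {E : Set (Vec n)} (hE : ∀ y ∈ E, ‖y‖ < 1 ∧ ‖mobiusT n x y‖ < r) (w : Vec n) :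
    (({z ∈ E | f z = w}).encard : ℝ≥0∞) ≤ ENNReal.ofReal (C₁ / (1 - r) ^ a) := by
  refine le_trans ?_ (hM x (by simpa [unitBall] using hx) r hr0 hr1 w)
  have hinj : InjOn (mobiusT n x) {z ∈ E | f z = w} := fun y hy z hz h => by
    rw [← mobiusT_neg_mobiusT hx0 hx (hE y hy.1).1, h, mobiusT_neg_mobiusT hx0 hx (hE z hz.1).1]
  rw [← hinj.encard_image]
  refine ENat.toENNReal_le.2 (encard_le_encard ?_)
  rintro _ ⟨y, hy, rfl⟩
  refine ⟨by simpa using (hE y hy.1).2, ?_⟩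
  rw [mobiusT_neg_mobiusT hx0 hx (hE y hy.1).1]
  exact hy.2

/-- Change of variables with multiplicity at most `N`. -/
lemma lintegral_abs_det_fderiv_mul_le {n : ℕ} {f : Vec n → Vec n} {E F : Set (Vec n)}
    (hE : MeasurableSet E) (hf : ∀ y ∈ E, DifferentiableAt ℝ f y) {N : ℝ≥0∞}
    (hN : ∀ w, (({z ∈ E | f z = w}).encard : ℝ≥0∞) ≤ N) (hF : MeasurableSet F)
    (hEF : MapsTo f E F) {g : Vec n → ℝ≥0∞} (hg : Measurable g) :
    ∫⁻ y in E, ENNReal.ofReal |(fderiv ℝ f y).det| * g (f y) ≤ N * ∫⁻ w in F, g w := by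
  set E' := {y ∈ E | (fderiv ℝ f y).det ≠ 0} with hE'
  have hdet : Measurable fun y => (fderiv ℝ f y).det :=
    ContinuousLinearMap.continuous_det.measurable.comp (measurable_fderiv ℝ f)
  have hE'm : MeasurableSet E' := hE.inter (hdet (measurableSet_singleton 0).compl)
  have hE'E : E' ⊆ E := fun y hy => hy.1
  have hf' : ∀ y ∈ E', HasFDerivWithinAt f (fderiv ℝ f y) E' y := fun y hy =>
    (hf y hy.1).hasFDerivAt.hasFDerivWithinAt
  have h1 : ∫⁻ y in E, ENNReal.ofReal |(fderiv ℝ f y).det| * g (f y)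
      ≤ ∫⁻ y in E', ENNReal.ofReal |(fderiv ℝ f y).det| * g (f y) := by
    rw [← lintegral_indicator hE, ← lintegral_indicator hE'm]
    refine lintegral_mono fun y => ?_
    by_cases hy : y ∈ E
    · by_cases hy' : (fderiv ℝ f y).det = 0
      · simp [indicator, hy, hy', hE']
      · simp [indicator, hy, hy', hE']
    · simp [indicator, hy]
  refine h1.trans ?_
  rcases E'.eq_empty_or_nonempty with he | hne
  · simp [he]
  have hrad : ∀ A : Vec n →L[ℝ] Vec n, ∃ r : ℝ≥0, r ≠ 0 ∧ (A.det ≠ 0 →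
      ∀ s : Set (Vec n), ApproximatesLinearOn f A s r → InjOn f s) := by
    intro A
    by_cases hA : A.det = 0
    · exact ⟨1, one_ne_zero, fun h => absurd hA h⟩
    · let B : Vec n ≃L[ℝ] Vec n := A.toContinuousLinearEquivOfDetNeZero hA
      have hB : (B : Vec n →L[ℝ] Vec n) = A := by
        ext1 v
        rfl
      rcases subsingleton_or_nontrivial (Vec n) with hs | hnt
      · exact ⟨1, one_ne_zero, fun _ s _ => Set.injOn_of_injective
          (Function.injective_of_subsingleton f)⟩
      have hBpos : 0 < ‖(B.symm : Vec n →L[ℝ] Vec n)‖₊ := B.nnnorm_symm_pos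
      refine ⟨‖(B.symm : Vec n →L[ℝ] Vec n)‖₊⁻¹ / 2, (by positivity), fun _ s hs => ?_⟩
      rw [← hB] at hs
      exact hs.injOn (Or.inr (NNReal.half_lt_self (by positivity)))
  choose r hr0 hr using hrad
  obtain ⟨t, A, hdisj, htm, hcov, happ, hA⟩ :=
    exists_partition_approximatesLinearOn_of_hasFDerivWithinAt f E' (fderiv ℝ f) hf' r hr0
  have hinj : ∀ k, InjOn f (E' ∩ t k) := fun k => by
    obtain ⟨y, hy, hAy⟩ := hA hne k
    exact hr (A k) (by rw [hAy]; exact hy.2) _ (happ k)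
  have hmk : ∀ k, MeasurableSet (E' ∩ t k) := fun k => hE'm.inter (htm k)
  have hfk : ∀ k, ∀ y ∈ E' ∩ t k, HasFDerivWithinAt f (fderiv ℝ f y) (E' ∩ t k) y := fun k y hy =>
    (hf' y hy.1).mono inter_subset_left
  have himg : ∀ k, MeasurableSet (f '' (E' ∩ t k)) := fun k =>
    measurable_image_of_fderivWithin (hmk k) (hfk k) (hinj k)
  calc ∫⁻ y in E', ENNReal.ofReal |(fderiv ℝ f y).det| * g (f y)
      = ∫⁻ y in ⋃ k, E' ∩ t k, ENNReal.ofReal |(fderiv ℝ f y).det| * g (f y) := by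
        rw [← inter_iUnion, inter_eq_left.2 hcov]
    _ = ∑' k, ∫⁻ y in E' ∩ t k, ENNReal.ofReal |(fderiv ℝ f y).det| * g (f y) :=
        lintegral_iUnion hmk (hdisj.mono fun i j h =>
          h.mono inter_subset_right inter_subset_right) _
    _ = ∑' k, ∫⁻ w in f '' (E' ∩ t k), g w := by
        refine tsum_congr fun k => ?_
        exact (lintegral_image_eq_lintegral_abs_det_fderiv_mul volume (hmk k) (hfk k)
          (hinj k) g).symm
    _ = ∫⁻ w, ∑' k, (f '' (E' ∩ t k)).indicator g w := by
        rw [lintegral_tsum fun k => (hg.indicator (himg k)).aemeasurable]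
        exact tsum_congr fun k => (lintegral_indicator (himg k) _).symm
    _ ≤ ∫⁻ w, N * F.indicator g w := by
        refine lintegral_mono fun w => ?_
        have hsum : ∑' k, (f '' (E' ∩ t k)).indicator g w
            = (∑' k, (f '' (E' ∩ t k)).indicator (fun _ => (1 : ℝ≥0∞)) w) * g w := by
          rw [← ENNReal.tsum_mul_right]
          refine tsum_congr fun k => ?_
          by_cases h : w ∈ f '' (E' ∩ t k) <;> simp [indicator, h]
        rw [hsum]
        by_cases hw : w ∈ F
        · rw [indicator_of_mem hw]
          gcongr
          refine le_trans ?_ (hN w)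
          set I := {k | w ∈ f '' (E' ∩ t k)} with hI
          have h2 : ∑' k, (f '' (E' ∩ t k)).indicator (fun _ => (1 : ℝ≥0∞)) w
              = (I.encard : ℝ≥0∞) := by
            rw [← ENNReal.tsum_set_one, tsum_subtype I (fun _ => (1 : ℝ≥0∞))]
            rfl
          rw [h2]
          refine ENat.toENNReal_le.2 ?_
          have hch : ∀ k : I, ∃ y, y ∈ E' ∩ t k ∧ f y = w := fun k => k.2
          choose φ hφ hφw using hch
          have hφi : Function.Injective φ := fun i j hij => by
            by_contra hne'
            have hne2 : (i : ℕ) ≠ j := fun h => hne' (Subtype.ext h)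
            exact (Set.disjoint_left.1 (hdisj hne2)) (hφ i).2 (hij ▸ (hφ j).2)
          calc I.encard = (range φ).encard := by
                rw [← image_univ, hφi.encard_image, encard_univ]
                rfl
            _ ≤ _ := encard_le_encard (by
                rintro _ ⟨k, rfl⟩
                exact ⟨(hφ k).1.1, hφw k⟩)
        · have : ∀ k, w ∉ f '' (E' ∩ t k) := by
            rintro k ⟨y, hy, rfl⟩
            exact hw (hEF hy.1.1)
          simp [this]
    _ = N * ∫⁻ w in F, g w := by
        rw [lintegral_const_mul _ (hg.indicator hF), lintegral_indicator hF]

lemma lintegral_Ico_inv {r R : ℝ} (hr : 0 < r) (hrR : r ≤ R) :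
    ∫⁻ s in Ico r R, ENNReal.ofReal s⁻¹ = ENNReal.ofReal (Real.log (R / r)) := by
  have hR : 0 < R := hr.trans_le hrR
  have h0 : (0 : ℝ) ∉ uIcc r R := by
    rw [uIcc_of_le hrR]
    exact fun h => absurd h.1 (not_le.2 hr)
  have hint : IntegrableOn (fun s : ℝ => s⁻¹) (Ioc r R) :=
    (intervalIntegrable_iff_integrableOn_Ioc_of_le hrR).1
      (intervalIntegral.intervalIntegrable_inv (fun x hx h => h0 (h ▸ hx)) continuousOn_id)
  rw [← integral_inv_of_pos hr hR, intervalIntegral.integral_of_le hrR,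
    restrict_Ico_eq_restrict_Ioc, ofReal_integral_eq_lintegral_ofReal hint]
  filter_upwards [ae_restrict_mem measurableSet_Ioc] with s hs
  exact inv_nonneg.2 (hr.trans hs.1).le

lemma lintegral_sector_inv_norm_pow_le {n : ℕ} (hn : 2 ≤ n) {r R : ℝ} (hr : 0 < r) (hrR : r ≤ R) :
    ∫⁻ w in sector r R (univ : Set (Vec n)), ENNReal.ofReal ((‖w‖ ^ n)⁻¹) ≤
      polarSphere n univ * ENNReal.ofReal (Real.log (R / r)) := by
  rw [setLIntegral_sector hn hr MeasurableSet.univ (by fun_prop), Measure.restrict_univ]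
  calc _ ≤ ∫⁻ ω, ENNReal.ofReal (Real.log (R / r)) ∂(polarSphere n) := by
        refine lintegral_mono_ae ?_
        filter_upwards [ae_mem_unitSphere n] with ω hω
        have hω1 : ‖ω‖ = 1 := by simpa [unitSphere] using hω
        rw [← lintegral_Ico_inv hr hrR]
        refine setLIntegral_mono' measurableSet_Ico fun s hs => ?_
        have hs0 : 0 < s := hr.trans_le hs.1
        rw [norm_smul, hω1, mul_one, Real.norm_of_nonneg hs0.le,
          ← ENNReal.ofReal_mul (by positivity)]
        refine ENNReal.ofReal_le_ofReal (le_of_eq ?_)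
        obtain ⟨m, rfl⟩ : ∃ m, n = m + 1 := ⟨n - 1, by omega⟩
        simp only [Nat.add_sub_cancel]
        field_simp
        rw [pow_succ]
    _ = _ := by rw [lintegral_const, mul_comm]

/-- The logarithmic gradient `|Df| / |f|`, extended by zero outside the ball. -/
def logGrad {n : ℕ} (f : Vec n → Vec n) : Vec n → ℝ≥0∞ :=
  (unitBall n).indicator fun y => ENNReal.ofReal (‖fderiv ℝ f y‖ / ‖f y‖)

lemma measurable_indicator_norm {n : ℕ} {f : Vec n → Vec n} (hf : ContinuousOn f (unitBall n)) :
    Measurable ((unitBall n).indicator fun y => ‖f y‖) := by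
  have hB : MeasurableSet (unitBall n) := isOpen_ball.measurableSet
  refine measurable_of_restrict_of_restrict_compl hB ?_ ?_
  · have : (unitBall n).domRestrict ((unitBall n).indicator fun y => ‖f y‖)
        = (unitBall n).domRestrict fun y => ‖f y‖ := by
      ext y; simp
    rw [this]
    exact hf.norm.domRestrict.measurable
  · have : (unitBall n)ᶜ.domRestrict ((unitBall n).indicator fun y => ‖f y‖) = fun _ => 0 := by
      ext y; simpa using fun h => absurd h y.2
    rw [this]
    exact measurable_const

lemma measurable_logGrad {n : ℕ} {f : Vec n → Vec n} (hf : ContinuousOn f (unitBall n)) :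
    Measurable (logGrad f) := by
  have h2 : logGrad f = (unitBall n).indicator fun y =>
      ENNReal.ofReal (‖fderiv ℝ f y‖ / (unitBall n).indicator (fun y => ‖f y‖) y) := by
    ext y
    by_cases hy : y ∈ unitBall n <;> simp [logGrad, hy]
  rw [h2]
  exact (((measurable_fderiv ℝ f).norm.div (measurable_indicator_norm hf)).ennreal_ofReal).indicator
    isOpen_ball.measurableSet

/-- Miniowitz bounds at points `y` of the shadow of `x`. -/
lemma InMiniowitz.norm_mem {n : ℕ} {C₀ α : ℝ} {f : Vec n → Vec n} (hC₀ : 1 ≤ C₀) (hα : 0 < α)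
    (hMin : InMiniowitz n C₀ α f) (hf0 : ∀ x ∈ unitBall n, f x ≠ 0)
    {x y : Vec n} (hx0 : x ≠ 0) (hx : ‖x‖ < 1) (hy : ‖y‖ < 1) {q : ℝ} (hq0 : 0 < q)
    (hT : ‖mobiusT n x y‖ < 1 - q) :
    C₀⁻¹ * (q / 2) ^ α * ‖f x‖ ≤ ‖f y‖ ∧ ‖f y‖ ≤ C₀ * (2 / q) ^ α * ‖f x‖ := by
  have h := hMin x (by simpa [unitBall] using hx) (mobiusT n x y)
    (by simp [unitBall]; linarith)
  rw [mobiusT_neg_zero, mobiusT_neg_mobiusT hx0 hx hy] at h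
  have hux : 0 < ‖f x‖ := norm_pos_iff.2 (hf0 x (by simpa [unitBall] using hx))
  have hT0 := norm_nonneg (mobiusT n x y)
  rw [le_div_iff₀ hux, div_le_iff₀ hux] at h
  constructor
  · refine le_trans ?_ h.1
    gcongr ?_ * ?_ ^ _ * _
    rw [le_div_iff₀ (by linarith)]
    nlinarith
  · refine h.2.trans ?_
    gcongr ?_ * ?_ ^ _ * _
    · exact div_nonneg (by linarith) (by linarith)
    rw [div_le_div_iff₀ (by linarith) hq0]
    nlinarith

/-- The logarithmic gradient of `f` has energy at most `A q ^ (-b)` on the part of the shadow of `x`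
where the distance to the sphere is at least `q` times that of `x`. -/
def LogEnergyBound (n : ℕ) (A b : ℝ) (f : Vec n → Vec n) : Prop :=
  ∀ x : Vec n, x ≠ 0 → ‖x‖ < 1 → ∀ q : ℝ, 0 < q → q ≤ 1 → ∀ E : Set (Vec n), MeasurableSet E →
    (∀ y ∈ E, ‖y‖ < 1 ∧ ‖x‖ ≤ ‖y‖ ∧ ‖y - x‖ ≤ 2 * (1 - ‖x‖) ∧ q * (1 - ‖x‖) ≤ 1 - ‖y‖) →
    ∫⁻ y in E, logGrad f y ^ n ≤ ENNReal.ofReal (A * q ^ (-b))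

lemma exists_logEnergyBound {n : ℕ} (hn : 2 ≤ n) {K C₀ α a C₁ : ℝ} (hK : 1 ≤ K)
    (hC₀ : 1 ≤ C₀) (hα : 0 < α) (ha0 : 0 ≤ a) (ha : a < (n : ℝ) - 1) (hC₁ : 0 < C₁)
    {f : Vec n → Vec n} (hf : IsQR n K f) (hf0 : ∀ x ∈ unitBall n, f x ≠ 0)
    (hMin : InMiniowitz n C₀ α f) (hM : MultCond n a C₁ f) :
    ∃ A b : ℝ, 0 < A ∧ 0 ≤ b ∧ b < (n : ℝ) - 1 ∧ LogEnergyBound n A b f := by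
  obtain ⟨hfc, hfd, hfq⟩ := hf
  set ε : ℝ := ((n : ℝ) - 1 - a) / (4 * α) with hε
  have hε0 : 0 < ε := div_pos (by linarith) (by positivity)
  set V : ℝ := (polarSphere n).real univ with hV
  have hVe : polarSphere n univ = ENNReal.ofReal V := by
    rw [hV, measureReal_def, ENNReal.ofReal_toReal (measure_ne_top _ _)]
  have hV0 : 0 ≤ V := by positivity
  refine ⟨K * (C₁ * 20 ^ a * ((V + 1) * ((2 * C₀ ^ 2 * 40 ^ (2 * α)) ^ ε / ε))), a + 2 * α * ε,
    by positivity, by positivity, ?_, ?_⟩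
  · have : 2 * α * ε = ((n : ℝ) - 1 - a) / 2 := by rw [hε]; field_simp; ring
    linarith
  intro x hx0 hx q hq0 hq1 E hE hEy
  have hT : ∀ y ∈ E, ‖mobiusT n x y‖ < 1 - q / 20 := fun y hy =>
    norm_mobiusT_lt hx0 hx (hEy y hy).1 (hEy y hy).2.1 (hEy y hy).2.2.1 (hEy y hy).2.2.2
  have hux : 0 < ‖f x‖ := norm_pos_iff.2 (hf0 x (by simpa [unitBall] using hx))
  have hEB : E ⊆ unitBall n := fun y hy => by simpa [unitBall] using (hEy y hy).1
  set r : ℝ := C₀⁻¹ * (q / 20 / 2) ^ α * ‖f x‖ with hr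
  set R : ℝ := 2 * (C₀ * (2 / (q / 20)) ^ α * ‖f x‖) with hR
  have hr0 : 0 < r := by positivity
  have hR0 : 0 < R := by positivity
  have hmaps : MapsTo f E (sector r R univ) := by
    intro y hy
    have h := hMin.norm_mem hC₀ hα hf0 hx0 hx (hEy y hy).1 (q := q / 20) (by positivity) (hT y hy)
    refine ⟨⟨h.1, h.2.trans_lt ?_⟩, mem_univ _⟩
    have : 0 < C₀ * (2 / (q / 20)) ^ α * ‖f x‖ := by positivity
    linarith
  have hRr : R / r = 2 * C₀ ^ 2 * 40 ^ (2 * α) * q ^ (-(2 * α)) := by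
    have e1 : 2 / (q / 20) = 40 * q⁻¹ := by field_simp; norm_num
    have e2 : q / 20 / 2 = (40 * q⁻¹)⁻¹ := by field_simp; norm_num
    rw [hR, hr, e1, e2, Real.inv_rpow (by positivity), Real.mul_rpow (by norm_num) (by positivity),
      Real.inv_rpow hq0.le, Real.rpow_neg hq0.le, two_mul α, Real.rpow_add (by norm_num),
      Real.rpow_add hq0]
    field_simp
  have hrR : r ≤ R := by
    rw [← one_le_div hr0, hRr]
    have h1 : 1 ≤ C₀ ^ 2 := one_le_pow₀ hC₀
    have h2 : (1 : ℝ) ≤ 40 ^ (2 * α) := Real.one_le_rpow (by norm_num) (by positivity)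
    have h3 : 1 ≤ q ^ (-(2 * α)) :=
      Real.one_le_rpow_of_pos_of_le_one_of_nonpos hq0 hq1 (by linarith)
    have h4 : 1 ≤ C₀ ^ 2 * 40 ^ (2 * α) * q ^ (-(2 * α)) :=
      one_le_mul_of_one_le_of_one_le (one_le_mul_of_one_le_of_one_le h1 h2) h3
    linarith
  have hlog : Real.log (R / r) ≤ (2 * C₀ ^ 2 * 40 ^ (2 * α)) ^ ε / ε * q ^ (-(2 * α * ε)) := by
    refine (Real.log_le_rpow_div (by positivity) hε0).trans (le_of_eq ?_)
    rw [hRr, Real.mul_rpow (by positivity) (by positivity), ← Real.rpow_mul hq0.le, neg_mul]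
    ring
  have hann := lintegral_sector_inv_norm_pow_le hn hr0 hrR
  have hchange := lintegral_abs_det_fderiv_mul_le hE (fun y hy => hfd y (hEB hy))
    (hM.encard_le hx0 hx (r := 1 - q / 20) (by linarith) (by linarith)
      fun y hy => ⟨(hEy y hy).1, hT y hy⟩)
    (measurableSet_sector r R MeasurableSet.univ) hmaps
    (g := fun w => ENNReal.ofReal ((‖w‖ ^ n)⁻¹)) (by fun_prop)
  calc ∫⁻ y in E, logGrad f y ^ n
      ≤ ∫⁻ y in E, ENNReal.ofReal K * (ENNReal.ofReal |(fderiv ℝ f y).det| *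
          ENNReal.ofReal ((‖f y‖ ^ n)⁻¹)) := by
        refine lintegral_mono_ae ?_
        filter_upwards [ae_mono (Measure.restrict_mono hEB le_rfl) hfq, ae_restrict_mem hE]
          with y hy hyE
        rw [logGrad, indicator_of_mem (hEB hyE), ← ENNReal.ofReal_pow (by positivity),
          ← ENNReal.ofReal_mul (abs_nonneg _), ← ENNReal.ofReal_mul (by linarith), div_pow,
          div_eq_mul_inv, ← mul_assoc]
        refine ENNReal.ofReal_le_ofReal ?_
        gcongr
        exact hy.trans (mul_le_mul_of_nonneg_left (le_abs_self _) (by linarith))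
    _ = ENNReal.ofReal K * ∫⁻ y in E, (ENNReal.ofReal |(fderiv ℝ f y).det| *
          ENNReal.ofReal ((‖f y‖ ^ n)⁻¹)) := lintegral_const_mul' _ _ ENNReal.ofReal_ne_top
    _ ≤ ENNReal.ofReal K * (ENNReal.ofReal (C₁ / (1 - (1 - q / 20)) ^ a) *
          (ENNReal.ofReal V * ENNReal.ofReal (Real.log (R / r)))) := by
        gcongr
        refine hchange.trans ?_
        gcongr
        rwa [← hVe]
    _ ≤ _ := by
        rw [← ENNReal.ofReal_mul hV0, ← ENNReal.ofReal_mul (by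
            rw [sub_sub_cancel]; positivity), ← ENNReal.ofReal_mul (by linarith)]
        refine ENNReal.ofReal_le_ofReal ?_
        have e3 : C₁ / (1 - (1 - q / 20)) ^ a = C₁ * 20 ^ a * q ^ (-a) := by
          rw [sub_sub_cancel, Real.div_rpow hq0.le (by norm_num), Real.rpow_neg hq0.le]
          field_simp
        have hlog0 : 0 ≤ Real.log (R / r) := Real.log_nonneg ((one_le_div hr0).2 hrR)
        calc _ ≤ K * (C₁ * 20 ^ a * q ^ (-a) * ((V + 1) *
              ((2 * C₀ ^ 2 * 40 ^ (2 * α)) ^ ε / ε * q ^ (-(2 * α * ε))))) := by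
              rw [e3]
              gcongr
              linarith
          _ = _ := by
              rw [neg_add, Real.rpow_add hq0]
              ring

lemma ENNReal.le_inv_pow_mul_pow_succ_add {l : ℝ} (hl : 0 < l) (h : ℝ≥0∞) (m : ℕ) :
    h ≤ ENNReal.ofReal (l⁻¹ ^ m) * h ^ (m + 1) + ENNReal.ofReal l := by
  rcases le_or_gt h (ENNReal.ofReal l) with h1 | h1
  · exact h1.trans le_add_self
  · refine le_trans ?_ le_self_add
    have h2 : 1 ≤ ENNReal.ofReal l⁻¹ * h := by
      calc (1 : ℝ≥0∞) = ENNReal.ofReal l⁻¹ * ENNReal.ofReal l := by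
            rw [← ENNReal.ofReal_mul (by positivity), inv_mul_cancel₀ hl.ne', ENNReal.ofReal_one]
        _ ≤ _ := by gcongr
    calc h = 1 * h := (one_mul h).symm
      _ ≤ (ENNReal.ofReal l⁻¹ * h) ^ m * h := by gcongr; exact one_le_pow₀ h2
      _ = _ := by rw [mul_pow, ENNReal.ofReal_pow (by positivity)]; ring

lemma norm_sub_le_of_mem_sector {n : ℕ} {x y : Vec n} (hx0 : x ≠ 0)
    (hy : y ∈ sector ‖x‖ 1 (ball (‖x‖⁻¹ • x) (1 - ‖x‖))) : ‖y - x‖ ≤ 2 * (1 - ‖x‖) := by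
  obtain ⟨⟨h1, h2⟩, h3⟩ := hy
  rw [mem_ball, dist_eq_norm] at h3
  have hx : 0 < ‖x‖ := norm_pos_iff.2 hx0
  have hy0 : 0 < ‖y‖ := hx.trans_le h1
  have e : y - x = ‖y‖ • (‖y‖⁻¹ • y - ‖x‖⁻¹ • x) + (‖y‖ - ‖x‖) • (‖x‖⁻¹ • x) := by
    rw [smul_sub, smul_smul, smul_smul, sub_smul, smul_smul, smul_smul, mul_inv_cancel₀ hy0.ne',
      mul_inv_cancel₀ hx.ne', one_smul, one_smul]
    abel
  have h4 : ‖‖x‖⁻¹ • x‖ = 1 := by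
    rw [norm_smul, norm_inv, norm_norm, inv_mul_cancel₀ hx.ne']
  rw [e]
  refine (norm_add_le _ _).trans ?_
  rw [norm_smul, norm_smul, h4, norm_norm, Real.norm_of_nonneg (by linarith)]
  nlinarith [norm_nonneg (‖y‖⁻¹ • y - ‖x‖⁻¹ • x)]

/-- The logarithmic gradient is integrable on the shadow of `x`, with the natural scaling. -/
lemma LogEnergyBound.exists_lintegral_logGrad_le {n : ℕ} (hn : 2 ≤ n) {A b : ℝ}
    {f : Vec n → Vec n} (hE : LogEnergyBound n A b f) (hA : 0 < A) (hb0 : 0 ≤ b)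
    (hb : b < (n : ℝ) - 1) :
    ∃ D : ℝ, 0 ≤ D ∧ ∀ x : Vec n, 1 / 2 ≤ ‖x‖ → ‖x‖ < 1 →
      ∫⁻ y in sector ‖x‖ 1 (ball (‖x‖⁻¹ • x) (1 - ‖x‖)), logGrad f y ≤
        ENNReal.ofReal (D * (1 - ‖x‖) ^ (n - 1)) := by
  obtain ⟨C, hC, hcap⟩ := exists_polarSphere_closedBall_le hn
  have hn1 : (1 : ℝ) ≤ (n : ℝ) - 1 := by
    have : (2 : ℝ) ≤ n := by exact_mod_cast hn
    linarith
  set γ : ℝ := b / ((n : ℝ) - 1) with hγ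
  have hγ1 : γ < 1 := (div_lt_one (by linarith)).2 hb
  have hγb : γ * ((n : ℝ) - 1) = b := div_mul_cancel₀ _ (by linarith)
  set δ : ℝ := (1 - γ) / 2 with hδ
  have hδ0 : 0 < δ := by rw [hδ]; linarith
  set β : ℝ := (1 + γ) / 2 with hβ
  have hρ : (1 / 2 : ℝ) ^ δ < 1 := Real.rpow_lt_one (by norm_num) (by norm_num) hδ0
  set S : ℝ := ∑' k : ℕ, ((1 / 2 : ℝ) ^ δ) ^ k with hS
  have hsum : Summable fun k : ℕ => ((1 / 2 : ℝ) ^ δ) ^ k :=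
    summable_geometric_of_lt_one (by positivity) hρ
  have hS0 : 0 ≤ S := tsum_nonneg fun k => by positivity
  refine ⟨(A + C) * S, by positivity, fun x hx2 hx1 => ?_⟩
  have hx0 : x ≠ 0 := norm_pos_iff.1 (by linarith)
  have hξ : ‖x‖⁻¹ • x ∈ unitSphere n := by
    simp [unitSphere, norm_smul, inv_mul_cancel₀ (norm_ne_zero_iff.2 hx0)]
  set t : ℝ := 1 - ‖x‖ with ht
  have ht0 : 0 < t := by rw [ht]; linarith
  have ht2 : t ≤ 1 / 2 := by rw [ht]; linarith
  set B : Set (Vec n) := ball (‖x‖⁻¹ • x) t with hB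
  have hBm : MeasurableSet B := isOpen_ball.measurableSet
  set E : ℕ → Set (Vec n) := fun k => sector (1 - (1 / 2) ^ k * t) (1 - (1 / 2) ^ (k + 1) * t) B
    with hEdef
  have hcover : sector ‖x‖ 1 B ⊆ ⋃ k, E k := by
    intro y hy
    obtain ⟨⟨h1, h2⟩, h3⟩ := hy
    obtain ⟨k, hk1, hk2⟩ := exists_nat_pow_near_of_lt_one (x := (1 - ‖y‖) / t) (y := (1 / 2 : ℝ))
      (div_pos (by linarith) ht0) ((div_le_one ht0).2 (by rw [ht]; linarith)) (by norm_num)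
      (by norm_num)
    rw [lt_div_iff₀ ht0] at hk1
    rw [div_le_iff₀ ht0] at hk2
    exact mem_iUnion.2 ⟨k, ⟨by linarith, by linarith⟩, h3⟩
  have hlayer : ∀ k : ℕ, ∫⁻ y in E k, logGrad f y ≤
      ENNReal.ofReal ((A + C) * t ^ (n - 1) * ((1 / 2 : ℝ) ^ δ) ^ k) := by
    intro k
    set q : ℝ := (1 / 2) ^ (k + 1) with hq
    have hq0 : 0 < q := by positivity
    have hq1 : q ≤ 1 := pow_le_one₀ (by norm_num) (by norm_num)
    have hq2 : (1 / 2 : ℝ) ^ k = 2 * q := by rw [hq, pow_succ]; ring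
    have hk1 : (1 / 2 : ℝ) ^ k ≤ 1 := pow_le_one₀ (by norm_num) (by norm_num)
    have hEm : MeasurableSet (E k) := measurableSet_sector _ _ hBm
    have hen := hE x hx0 hx1 q hq0 hq1 (E k) hEm (by
      rintro y ⟨⟨h1, h2⟩, h3⟩
      have hy1 : ‖y‖ < 1 := by nlinarith
      have hxy : ‖x‖ ≤ ‖y‖ := by nlinarith
      exact ⟨hy1, hxy, norm_sub_le_of_mem_sector hx0 ⟨⟨hxy, hy1⟩, h3⟩, by linarith⟩)
    have hvol : volume (E k) ≤ ENNReal.ofReal (q * t * (C * t ^ (n - 1))) := by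
      refine (volume_sector_le hn (by nlinarith) (by nlinarith) hBm).trans ?_
      rw [ENNReal.ofReal_mul (by positivity)]
      gcongr
      · rw [hq2]; linarith
      · exact (measure_mono ball_subset_closedBall).trans (hcap _ hξ t ht0 ht2)
    set l : ℝ := q ^ (-β) / t with hl
    have hl0 : 0 < l := by positivity
    obtain ⟨m, hm⟩ : ∃ m, n = m + 1 := ⟨n - 1, by omega⟩
    have hm' : (n : ℝ) - 1 = m := by rw [hm]; push_cast; ring
    have hm'' : n - 1 = m := by omega
    calc ∫⁻ y in E k, logGrad f y
        ≤ ∫⁻ y in E k, (ENNReal.ofReal (l⁻¹ ^ m) * logGrad f y ^ n + ENNReal.ofReal l) := by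
          refine lintegral_mono fun y => ?_
          have := ENNReal.le_inv_pow_mul_pow_succ_add hl0 (logGrad f y) m
          rwa [← hm] at this
      _ = ENNReal.ofReal (l⁻¹ ^ m) * (∫⁻ y in E k, logGrad f y ^ n)
            + ENNReal.ofReal l * volume (E k) := by
          rw [lintegral_add_right _ measurable_const,
            lintegral_const_mul' _ _ ENNReal.ofReal_ne_top]
          simp
      _ ≤ ENNReal.ofReal (l⁻¹ ^ m) * ENNReal.ofReal (A * q ^ (-b))
            + ENNReal.ofReal l * ENNReal.ofReal (q * t * (C * t ^ (n - 1))) := by gcongr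
      _ = ENNReal.ofReal (l⁻¹ ^ m * (A * q ^ (-b)) + l * (q * t * (C * t ^ (n - 1)))) := by
          rw [← ENNReal.ofReal_mul (by positivity), ← ENNReal.ofReal_mul (by positivity),
            ← ENNReal.ofReal_add (by positivity) (by positivity)]
      _ ≤ _ := by
          refine ENNReal.ofReal_le_ofReal ?_
          have e1 : l⁻¹ ^ m * (A * q ^ (-b)) = A * t ^ m * q ^ (β * m - b) := by
            rw [hl, inv_div, div_pow, sub_eq_add_neg, Real.rpow_add hq0, ← Real.rpow_natCast (q ^ _),
              ← Real.rpow_mul hq0.le, neg_mul, Real.rpow_neg hq0.le (β * m)]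
            field_simp
          have e2 : l * (q * t * (C * t ^ (n - 1))) = C * t ^ m * q ^ (1 - β) := by
            rw [hl, hm'', sub_eq_add_neg, Real.rpow_add hq0, Real.rpow_one]
            field_simp
          have i1 : q ^ (β * m - b) ≤ q ^ δ := by
            refine Real.rpow_le_rpow_of_exponent_ge hq0 hq1 ?_
            rw [hm'] at hγb hn1
            rw [hβ, hδ]
            nlinarith
          have i2 : q ^ (1 - β) = q ^ δ := by congr 1; rw [hβ, hδ]; ring
          have i3 : q ^ δ ≤ ((1 / 2 : ℝ) ^ δ) ^ k := by
            rw [← Real.rpow_natCast, ← Real.rpow_mul (by norm_num), mul_comm δ,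
              Real.rpow_mul (by norm_num), Real.rpow_natCast]
            refine Real.rpow_le_rpow hq0.le ?_ hδ0.le
            rw [hq2]; linarith
          rw [e1, e2, i2, hm'']
          calc _ ≤ A * t ^ m * ((1 / 2 : ℝ) ^ δ) ^ k + C * t ^ m * ((1 / 2 : ℝ) ^ δ) ^ k := by
                gcongr
                exact i1.trans i3
            _ = _ := by ring
  calc _ ≤ ∫⁻ y in ⋃ k, E k, logGrad f y := lintegral_mono_set hcover
    _ ≤ ∑' k, ∫⁻ y in E k, logGrad f y := lintegral_iUnion_le _ _
    _ ≤ ∑' k : ℕ, ENNReal.ofReal ((A + C) * t ^ (n - 1) * ((1 / 2 : ℝ) ^ δ) ^ k) :=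
        ENNReal.tsum_le_tsum hlayer
    _ = _ := by
        rw [← ENNReal.ofReal_tsum_of_nonneg (fun k => by positivity) (hsum.mul_left _),
          tsum_mul_left]
        congr 1
        ring

/-- Along a ray, `log |f|` decreases at most by the integral of the logarithmic gradient. -/
lemma ofReal_log_norm_sub_le_lintegral_logGrad {n : ℕ} {f : Vec n → Vec n}
    (hfc : ContinuousOn f (unitBall n)) (hfd : ∀ x ∈ unitBall n, DifferentiableAt ℝ f x)
    (hf0 : ∀ x ∈ unitBall n, f x ≠ 0) {ω : Vec n} (hω : ‖ω‖ = 1) {s₀ ρ : ℝ} (hs₀ : 0 < s₀)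
    (hsρ : s₀ ≤ ρ) (hρ : ρ < 1) :
    ENNReal.ofReal (Real.log ‖f (s₀ • ω)‖ - Real.log ‖f (ρ • ω)‖) ≤
      ∫⁻ s in Ico s₀ ρ, logGrad f (s • ω) := by
  rcases eq_or_ne (∫⁻ s in Ico s₀ ρ, logGrad f (s • ω)) ⊤ with htop | htop
  · rw [htop]; exact le_top
  have hball : ∀ s ∈ Icc s₀ ρ, s • ω ∈ unitBall n := by
    intro s hs
    simp only [unitBall, mem_ball, dist_zero_right, norm_smul, hω, mul_one]
    rw [Real.norm_of_nonneg (hs₀.le.trans hs.1)]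
    exact hs.2.trans_lt hρ
  have hcont : ContinuousOn (fun s : ℝ => f (s • ω)) (Icc s₀ ρ) :=
    hfc.comp (by fun_prop) hball
  have hmeas : Measurable fun s : ℝ => logGrad f (s • ω) :=
    (measurable_logGrad hfc).comp (by fun_prop)
  have hφ : IntegrableOn (fun s : ℝ => (logGrad f (s • ω)).toReal) (Ico s₀ ρ) :=
    integrable_toReal_of_lintegral_ne_top hmeas.aemeasurable htop
  have key := intervalIntegral.sub_le_integral_of_hasDeriv_right_of_le (a := s₀) (b := ρ)
    (g := fun s : ℝ => -(Real.log (‖f (s • ω)‖ ^ 2) / 2))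
    (g' := fun s => -((2 * inner ℝ (f (s • ω)) (fderiv ℝ f (s • ω) ω)) /
      ‖f (s • ω)‖ ^ 2 / 2)) (φ := fun s => (logGrad f (s • ω)).toReal) hsρ
    (by
      refine ((ContinuousOn.log (hcont.norm.pow 2) fun s hs => ?_).div_const 2).neg
      exact pow_ne_zero _ (norm_ne_zero_iff.2 (hf0 _ (hball s hs))))
    (fun s hs => by
      have hs' := hball s (Ioo_subset_Icc_self hs)
      have h1 : HasDerivAt (fun s : ℝ => s • ω) ω s := by
        simpa using (hasDerivAt_id s).smul_const ω
      have h2 : HasDerivAt (fun s : ℝ => f (s • ω)) (fderiv ℝ f (s • ω) ω) s :=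
        (hfd _ hs').hasFDerivAt.comp_hasDerivAt s h1
      exact (((h2.norm_sq.log (pow_ne_zero _ (norm_ne_zero_iff.2 (hf0 _ hs')))).div_const
        2).neg).hasDerivWithinAt)
    (by rwa [integrableOn_Icc_iff_integrableOn_Ico])
    (fun s hs => by
      have hs' := hball s (Ioo_subset_Icc_self hs)
      have hu : 0 < ‖f (s • ω)‖ := norm_pos_iff.2 (hf0 _ hs')
      rw [logGrad, indicator_of_mem hs', ENNReal.toReal_ofReal (by positivity),
        show ∀ u v : ℝ, 2 * u / v / 2 = u / v from fun u v => by ring, ← neg_div]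
      have h3 : -inner ℝ (f (s • ω)) (fderiv ℝ f (s • ω) ω) ≤
          ‖f (s • ω)‖ * ‖fderiv ℝ f (s • ω)‖ := by
        refine (neg_le_abs _).trans ((abs_real_inner_le_norm _ _).trans ?_)
        gcongr
        simpa [hω] using (fderiv ℝ f (s • ω)).le_opNorm ω
      rw [div_le_div_iff₀ (by positivity) hu]
      nlinarith)
  simp only [Real.log_pow] at key
  rw [intervalIntegral.integral_of_le hsρ, ← restrict_Ico_eq_restrict_Ioc,
    integral_toReal hmeas.aemeasurable (ae_lt_top hmeas htop)] at key
  refine ENNReal.ofReal_le_of_le_toReal (le_trans (le_of_eq ?_) key)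
  push_cast
  ring

/-- On a fixed proportion of the shadow of `x`, the values of `f` on the sphere of radius `ρ` are
bounded from below by a multiple of `|f x|`. -/
lemma exists_le_polarSphere_shadow {n : ℕ} (hn : 2 ≤ n) {K C₀ α a C₁ : ℝ} (hK : 1 ≤ K)
    (hC₀ : 1 ≤ C₀) (hα : 0 < α) (ha0 : 0 ≤ a) (ha : a < (n : ℝ) - 1) (hC₁ : 0 < C₁)
    {f : Vec n → Vec n} (hf : IsQR n K f) (hf0 : ∀ x ∈ unitBall n, f x ≠ 0)
    (hMin : InMiniowitz n C₀ α f) (hM : MultCond n a C₁ f) :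
    ∃ c ε : ℝ, 0 < c ∧ 0 < ε ∧ ∀ ρ : ℝ, ρ < 1 → ∀ x : Vec n, 1 / 2 ≤ ‖x‖ → ‖x‖ ≤ ρ →
      ENNReal.ofReal (c * (1 - ‖x‖) ^ (n - 1)) ≤
        polarSphere n {ω ∈ ball (‖x‖⁻¹ • x) (1 - ‖x‖) | ε * ‖f x‖ ≤ ‖f (ρ • ω)‖} := by
  obtain ⟨A, b, hA, hb0, hb, hE⟩ := exists_logEnergyBound hn hK hC₀ hα ha0 ha hC₁ hf hf0 hMin hM
  obtain ⟨D, hD, hDx⟩ := hE.exists_lintegral_logGrad_le hn hA hb0 hb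
  obtain ⟨c, hc, hcap⟩ := exists_le_polarSphere_ball hn
  obtain ⟨hfc, hfd, -⟩ := hf
  set κ : ℝ := C₀⁻¹ * (1 / 20 / 2) ^ α with hκ
  have hκ0 : 0 < κ := by positivity
  set Λ : ℝ := 2 ^ n * D / c + 1 with hΛ
  have hΛ0 : 0 < Λ := by positivity
  refine ⟨c / 2, κ * Real.exp (-Λ), by positivity, by positivity, fun ρ hρ x hx2 hxρ => ?_⟩
  have hx1 : ‖x‖ < 1 := hxρ.trans_lt hρ
  have hx0 : x ≠ 0 := norm_pos_iff.1 (by linarith)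
  have hξ : ‖x‖⁻¹ • x ∈ unitSphere n := by
    simp [unitSphere, norm_smul, inv_mul_cancel₀ (norm_ne_zero_iff.2 hx0)]
  have hux : 0 < ‖f x‖ := norm_pos_iff.2 (hf0 x (by simpa [unitBall] using hx1))
  set t : ℝ := 1 - ‖x‖ with ht
  have ht0 : 0 < t := by rw [ht]; linarith
  have ht2 : t ≤ 1 / 2 := by rw [ht]; linarith
  set B : Set (Vec n) := ball (‖x‖⁻¹ • x) t with hB
  have hBm : MeasurableSet B := isOpen_ball.measurableSet
  set L : Vec n → ℝ≥0∞ := fun ω => ∫⁻ s in Ico ‖x‖ ρ, logGrad f (s • ω) with hL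
  have hLm : Measurable L := by
    have : Measurable fun z : Vec n × ℝ => logGrad f (z.2 • z.1) :=
      (measurable_logGrad hfc).comp (by fun_prop)
    exact this.lintegral_prod_right'
  have hLint : ∫⁻ ω in B, L ω ∂(polarSphere n) ≤
      ENNReal.ofReal (2 ^ (n - 1) * D * t ^ (n - 1)) := by
    calc _ ≤ ∫⁻ ω in B, ENNReal.ofReal (2 ^ (n - 1)) * (∫⁻ s in Ico ‖x‖ 1,
            ENNReal.ofReal (s ^ (n - 1)) * logGrad f (s • ω)) ∂(polarSphere n) := by
          refine lintegral_mono fun ω => ?_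
          rw [← lintegral_const_mul' _ _ ENNReal.ofReal_ne_top]
          refine (lintegral_mono_set (Ico_subset_Ico_right hρ.le)).trans ?_
          refine setLIntegral_mono' measurableSet_Ico fun s hs => ?_
          rw [← mul_assoc, ← ENNReal.ofReal_mul (by positivity), ← mul_pow]
          refine le_mul_of_one_le_left' ?_
          rw [ENNReal.one_le_ofReal]
          exact one_le_pow₀ (by linarith [hs.1])
      _ = ENNReal.ofReal (2 ^ (n - 1)) * ∫⁻ y in sector ‖x‖ 1 B, logGrad f y := by
          rw [lintegral_const_mul' _ _ ENNReal.ofReal_ne_top,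
            setLIntegral_sector hn (by linarith) hBm (measurable_logGrad hfc)]
      _ ≤ _ := by
          rw [mul_assoc, ENNReal.ofReal_mul (by positivity)]
          gcongr
          exact hDx x hx2 hx1
  have hbad : polarSphere n (B ∩ {ω | ENNReal.ofReal Λ ≤ L ω}) ≤
      ENNReal.ofReal (c / 2 * t ^ (n - 1)) := by
    have h1 := mul_meas_ge_le_lintegral (μ := (polarSphere n).restrict B) hLm (ENNReal.ofReal Λ)
    rw [Measure.restrict_apply (measurableSet_le measurable_const hLm), inter_comm] at h1
    have h2 := h1.trans hLint
    have h3 : ENNReal.ofReal (2 ^ (n - 1) * D * t ^ (n - 1)) ≤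
        ENNReal.ofReal Λ * ENNReal.ofReal (c / 2 * t ^ (n - 1)) := by
      rw [← ENNReal.ofReal_mul hΛ0.le]
      refine ENNReal.ofReal_le_ofReal ?_
      have e : (2 : ℝ) ^ n = 2 * 2 ^ (n - 1) := by rw [← pow_succ']; congr 1; omega
      have : Λ * (c / 2 * t ^ (n - 1)) = 2 ^ (n - 1) * D * t ^ (n - 1) + c / 2 * t ^ (n - 1) := by
        rw [hΛ, e]; field_simp
      rw [this]
      have : 0 < c / 2 * t ^ (n - 1) := by positivity
      linarith
    exact (ENNReal.mul_le_mul_iff_right (by simpa using hΛ0) ENNReal.ofReal_ne_top).1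
      (h2.trans h3)
  set G : Set (Vec n) := {ω ∈ B | κ * Real.exp (-Λ) * ‖f x‖ ≤ ‖f (ρ • ω)‖} with hG
  have hsub : B ⊆ (G ∪ B ∩ {ω | ENNReal.ofReal Λ ≤ L ω}) ∪ (unitSphere n)ᶜ := by
    intro ω hω
    by_cases hωS : ω ∈ unitSphere n
    swap
    · exact Or.inr hωS
    refine Or.inl ?_
    by_cases hωG : κ * Real.exp (-Λ) * ‖f x‖ ≤ ‖f (ρ • ω)‖
    · exact Or.inl ⟨hω, hωG⟩
    refine Or.inr ⟨hω, ?_⟩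
    have hω1 : ‖ω‖ = 1 := by simpa [unitSphere] using hωS
    have hn1 : ‖‖x‖ • ω‖ = ‖x‖ := by rw [norm_smul, hω1, norm_norm, mul_one]
    refine le_trans (ENNReal.ofReal_le_ofReal ?_)
      (ofReal_log_norm_sub_le_lintegral_logGrad hfc hfd hf0 hω1 (by linarith) hxρ hρ)
    have hmem : ‖x‖ • ω ∈ sector ‖x‖ 1 B := by
      refine ⟨by rw [hn1]; exact ⟨le_rfl, hx1⟩, ?_⟩
      rw [hn1, smul_smul, inv_mul_cancel₀ (norm_ne_zero_iff.2 hx0), one_smul]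
      exact hω
    have hT := norm_mobiusT_lt hx0 hx1 (by rw [hn1]; exact hx1) hn1.ge
      (norm_sub_le_of_mem_sector hx0 hmem) (q := 1) (by rw [hn1, one_mul])
    have h4 := (hMin.norm_mem hC₀ hα hf0 hx0 hx1 (by rw [hn1]; exact hx1) (by norm_num) hT).1
    have hρω : 0 < ‖f (ρ • ω)‖ := by
      refine norm_pos_iff.2 (hf0 _ ?_)
      simp only [unitBall, mem_ball, dist_zero_right, norm_smul, hω1, mul_one]
      rwa [Real.norm_of_nonneg (by linarith)]
    have h5 : ‖f (ρ • ω)‖ ≤ Real.exp (-Λ) * ‖f (‖x‖ • ω)‖ := by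
      calc _ ≤ κ * Real.exp (-Λ) * ‖f x‖ := (not_le.1 hωG).le
        _ = Real.exp (-Λ) * (κ * ‖f x‖) := by ring
        _ ≤ _ := by gcongr
    have hxω : 0 < ‖f (‖x‖ • ω)‖ := lt_of_lt_of_le (by positivity) h4
    have h6 := Real.log_le_log hρω h5
    rw [Real.log_mul (Real.exp_ne_zero _) hxω.ne', Real.log_exp] at h6
    linarith
  have h7 := (hcap _ hξ t ht0 ht2).trans (measure_mono hsub)
  have h8 : polarSphere n ((G ∪ B ∩ {ω | ENNReal.ofReal Λ ≤ L ω}) ∪ (unitSphere n)ᶜ) ≤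
      polarSphere n G + ENNReal.ofReal (c / 2 * t ^ (n - 1)) := by
    refine (measure_union_le _ _).trans ?_
    rw [polarSphere_compl, add_zero]
    exact (measure_union_le _ _).trans (by gcongr)
  have h9 := h7.trans h8
  have h10 : c * t ^ (n - 1) = c / 2 * t ^ (n - 1) + c / 2 * t ^ (n - 1) := by ring
  rw [h10, ENNReal.ofReal_add (by positivity) (by positivity)] at h9
  exact (ENNReal.add_le_add_iff_right ENNReal.ofReal_ne_top).1 h9

lemma lintegral_min_inv_pow_rpow_le {m : ℕ} (hm : 1 ≤ m) {B X : ℝ} (hB : 0 < B) (hX : 0 ≤ X) :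
    ∫⁻ t in Ioi (0 : ℝ), ENNReal.ofReal (min X (B * (t ^ m)⁻¹) ^ (1 + 1 / (m : ℝ))) ≤
      ENNReal.ofReal (2 * B ^ (1 / (m : ℝ)) * X) := by
  have hm1 : (1 : ℝ) ≤ m := by exact_mod_cast hm
  have hm0 : (0 : ℝ) < m := by linarith
  rcases hX.eq_or_lt with rfl | hX
  · rw [setLIntegral_congr_fun (g := fun _ => 0) measurableSet_Ioi]
    · simp
    intro t ht
    have ht0 : (0 : ℝ) < t := ht
    simp only
    rw [min_eq_left (by positivity), Real.zero_rpow (by positivity), ENNReal.ofReal_zero]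
  set t₀ : ℝ := (B / X) ^ (1 / (m : ℝ)) with ht₀
  have ht₀0 : 0 < t₀ := by positivity
  have hpow : t₀ ^ (m : ℝ) = B / X := by
    rw [ht₀, ← Real.rpow_mul (by positivity), one_div_mul_cancel hm0.ne', Real.rpow_one]
  have h1 : ∫⁻ t in Ioc 0 t₀, ENNReal.ofReal (min X (B * (t ^ m)⁻¹) ^ (1 + 1 / (m : ℝ))) ≤
      ENNReal.ofReal (B ^ (1 / (m : ℝ)) * X) := by
    calc _ ≤ ∫⁻ t in Ioc 0 t₀, ENNReal.ofReal (X ^ (1 + 1 / (m : ℝ))) := by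
          refine setLIntegral_mono' measurableSet_Ioc fun t ht => ?_
          have ht0 : 0 < t := ht.1
          refine ENNReal.ofReal_le_ofReal (Real.rpow_le_rpow ?_ (min_le_left _ _) (by positivity))
          exact le_min hX.le (by positivity)
      _ = ENNReal.ofReal (X ^ (1 + 1 / (m : ℝ)) * t₀) := by
          rw [setLIntegral_const, Real.volume_Ioc, sub_zero, ENNReal.ofReal_mul (by positivity)]
      _ = _ := by
          rw [ht₀, Real.div_rpow hB.le hX.le, Real.rpow_add hX, Real.rpow_one]
          field_simp
  have h2 : ∫⁻ t in Ioi t₀, ENNReal.ofReal (min X (B * (t ^ m)⁻¹) ^ (1 + 1 / (m : ℝ))) ≤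
      ENNReal.ofReal (B ^ (1 / (m : ℝ)) * X) := by
    have hlt : -((m : ℝ) + 1) < -1 := by linarith
    calc _ ≤ ∫⁻ t in Ioi t₀, ENNReal.ofReal (B ^ (1 + 1 / (m : ℝ))) *
            ENNReal.ofReal (t ^ (-((m : ℝ) + 1))) := by
          refine setLIntegral_mono' measurableSet_Ioi fun t ht => ?_
          have ht0 : 0 < t := ht₀0.trans ht
          rw [← ENNReal.ofReal_mul (by positivity)]
          refine ENNReal.ofReal_le_ofReal ?_
          calc _ ≤ (B * (t ^ m)⁻¹) ^ (1 + 1 / (m : ℝ)) :=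
                Real.rpow_le_rpow (le_min hX.le (by positivity)) (min_le_right _ _) (by positivity)
            _ = _ := by
                rw [Real.mul_rpow hB.le (by positivity), ← Real.rpow_natCast t m,
                  ← Real.rpow_neg ht0.le, ← Real.rpow_mul ht0.le]
                congr 2
                field_simp
      _ = ENNReal.ofReal (B ^ (1 + 1 / (m : ℝ)) * (-t₀ ^ (-((m : ℝ) + 1) + 1) /
            (-((m : ℝ) + 1) + 1))) := by
          rw [lintegral_const_mul' _ _ ENNReal.ofReal_ne_top, ENNReal.ofReal_mul (by positivity),
            ← integral_Ioi_rpow_of_lt hlt ht₀0, ofReal_integral_eq_lintegral_ofReal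
              (integrableOn_Ioi_rpow_of_lt hlt ht₀0)]
          filter_upwards [ae_restrict_mem measurableSet_Ioi] with t ht
          exact Real.rpow_nonneg (ht₀0.trans ht).le _
      _ ≤ _ := by
          refine ENNReal.ofReal_le_ofReal ?_
          have e : -((m : ℝ) + 1) + 1 = -m := by ring
          rw [e, Real.rpow_neg ht₀0.le, hpow, neg_div_neg_eq, Real.rpow_add hB, Real.rpow_one,
            inv_div]
          calc _ = B ^ (1 / (m : ℝ)) * X / m := by field_simp
            _ ≤ _ := div_le_self (by positivity) hm1
  rw [← Ioc_union_Ioi_eq_Ioi ht₀0.le]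
  refine (lintegral_union_le _ _ _).trans ((add_le_add h1 h2).trans (le_of_eq ?_))
  rw [← ENNReal.ofReal_add (by positivity) (by positivity)]
  congr 1
  ring

/-- If every value of `U` is attained by `W` on a fixed proportion of the corresponding shadow, and
`U` has the natural growth, then `L^p` integrability of `W` on the sphere improves to
`L^{pn/(n-1)}` integrability of `U` on the shell. -/
lemma lintegral_sector_rpow_le_of_shadow {m : ℕ} (hm : 1 ≤ m) {p c C B ρ : ℝ} (hp : 0 < p)
    (hc : 0 < c) (hC : 0 < C) (hB : 0 < B) (hρ : ρ ≤ 1)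
    (hcap : ∀ ω ∈ unitSphere (m + 1), ∀ d : ℝ, 0 < d → d ≤ 1 / 2 →
      polarSphere (m + 1) (closedBall ω d) ≤ ENNReal.ofReal (C * d ^ m))
    {U W : Vec (m + 1) → ℝ} (hU : Measurable U) (hW : Measurable W) (hU0 : ∀ x, 0 ≤ U x)
    (hW0 : ∀ ω, 0 ≤ W ω)
    (hUB : ∀ x : Vec (m + 1), 1 / 2 ≤ ‖x‖ → ‖x‖ < ρ → U x ^ p ≤ B * ((1 - ‖x‖) ^ m)⁻¹)
    (hUW : ∀ x : Vec (m + 1), 1 / 2 ≤ ‖x‖ → ‖x‖ < ρ → ENNReal.ofReal (c * (1 - ‖x‖) ^ m) ≤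
      polarSphere (m + 1) {ω ∈ ball (‖x‖⁻¹ • x) (1 - ‖x‖) | U x ≤ W ω}) :
    ∫⁻ x in sector (1 / 2) ρ (univ : Set (Vec (m + 1))),
        ENNReal.ofReal (U x ^ (p * (1 + 1 / (m : ℝ)))) ≤
      ENNReal.ofReal (C / c * (2 * B ^ (1 / (m : ℝ)))) *
        ∫⁻ ω, ENNReal.ofReal (W ω ^ p) ∂(polarSphere (m + 1)) := by
  have hm1 : (1 : ℝ) ≤ m := by exact_mod_cast hm
  have hn : 2 ≤ m + 1 := by omega
  set P : ℝ := p * (1 + 1 / (m : ℝ)) with hP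
  have hAm : MeasurableSet (sector (1 / 2) ρ (univ : Set (Vec (m + 1)))) :=
    measurableSet_sector _ _ MeasurableSet.univ
  set T : Set (Vec (m + 1) × Vec (m + 1)) :=
    {z | dist z.2 (‖z.1‖⁻¹ • z.1) < 1 - ‖z.1‖ ∧ U z.1 ≤ W z.2} with hT
  have hTm : MeasurableSet T := by
    have h1 : Measurable fun z : Vec (m + 1) × Vec (m + 1) => dist z.2 (‖z.1‖⁻¹ • z.1) := by fun_prop
    have h2 : Measurable fun z : Vec (m + 1) × Vec (m + 1) => 1 - ‖z.1‖ := by fun_prop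
    exact (measurableSet_lt h1 h2).inter
      (measurableSet_le (hU.comp measurable_fst) (hW.comp measurable_snd))
  set Z : Vec (m + 1) × Vec (m + 1) → ℝ≥0∞ := T.indicator fun z =>
    ENNReal.ofReal (U z.1 ^ P * (c * (1 - ‖z.1‖) ^ m)⁻¹) with hZ
  have hZm : Measurable Z := by
    refine Measurable.indicator ?_ hTm
    exact (((hU.comp measurable_fst).pow_const P).mul (by fun_prop)).ennreal_ofReal
  have step1 : ∀ x ∈ sector (1 / 2) ρ (univ : Set (Vec (m + 1))),
      ENNReal.ofReal (U x ^ P) ≤ ∫⁻ ω, Z (x, ω) ∂(polarSphere (m + 1)) := by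
    rintro x ⟨⟨hx2, hxρ⟩, -⟩
    have ht : 0 < 1 - ‖x‖ := by linarith
    have hS : MeasurableSet {ω ∈ ball (‖x‖⁻¹ • x) (1 - ‖x‖) | U x ≤ W ω} :=
      isOpen_ball.measurableSet.inter (measurableSet_le measurable_const hW)
    have e : (fun ω => Z (x, ω)) = {ω ∈ ball (‖x‖⁻¹ • x) (1 - ‖x‖) | U x ≤ W ω}.indicator
        fun _ => ENNReal.ofReal (U x ^ P * (c * (1 - ‖x‖) ^ m)⁻¹) := by
      ext ω
      simp [hZ, hT, indicator]
    rw [e, lintegral_indicator_const hS]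
    refine le_trans (le_of_eq ?_) (mul_le_mul_right (hUW x hx2 hxρ) _)
    rw [← ENNReal.ofReal_mul (by have := hU0 x; positivity), mul_assoc,
      inv_mul_cancel₀ (by positivity), mul_one]
  have step2 : ∀ ω ∈ unitSphere (m + 1),
      ∫⁻ x in sector (1 / 2) ρ (univ : Set (Vec (m + 1))), Z (x, ω) ≤
        ENNReal.ofReal (C / c * (2 * B ^ (1 / (m : ℝ)))) * ENNReal.ofReal (W ω ^ p) := by
    intro ω hω
    have hZω : Measurable fun x => Z (x, ω) := hZm.comp (by fun_prop)
    rw [setLIntegral_sector hn (by norm_num) MeasurableSet.univ hZω, Measure.restrict_univ]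
    set X : ℝ := W ω ^ p with hX
    have hX0 : 0 ≤ X := Real.rpow_nonneg (hW0 ω) _
    set Φ : ℝ → ℝ≥0∞ := fun t => ENNReal.ofReal (min X (B * (t ^ m)⁻¹) ^ (1 + 1 / (m : ℝ))) with hΦ
    have hΦm : Measurable Φ := by
      refine Measurable.ennreal_ofReal (Measurable.pow_const ?_ _)
      fun_prop
    set Y : Vec (m + 1) × ℝ → ℝ≥0∞ := {z : Vec (m + 1) × ℝ | dist z.1 ω ≤ 1 - z.2}.indicator
      fun z => Φ (1 - z.2) * ENNReal.ofReal ((c * (1 - z.2) ^ m)⁻¹) with hY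
    have hYm : Measurable Y := by
      refine Measurable.indicator ?_ (measurableSet_le (by fun_prop) (by fun_prop))
      exact (hΦm.comp (by fun_prop)).mul (by fun_prop)
    calc _ ≤ ∫⁻ ξ, (∫⁻ s in Ico (1 / 2) ρ, Y (ξ, s)) ∂(polarSphere (m + 1)) := by
          refine lintegral_mono_ae ?_
          filter_upwards [ae_mem_unitSphere (m + 1)] with ξ hξ
          have hξ1 : ‖ξ‖ = 1 := by simpa [unitSphere] using hξ
          refine setLIntegral_mono' measurableSet_Ico fun s hs => ?_
          have hs0 : 0 < s := by linarith [hs.1]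
          have hs1 : 0 < 1 - s := by linarith [hs.2]
          have hns : ‖s • ξ‖ = s := by rw [norm_smul, hξ1, Real.norm_of_nonneg hs0.le, mul_one]
          simp only [hZ]
          by_cases hz : (s • ξ, ω) ∈ T
          swap
          · rw [indicator_of_notMem hz, mul_zero]
            exact zero_le
          have hz' := hz
          simp only [hT, mem_ofPred_eq, hns, smul_smul, inv_mul_cancel₀ hs0.ne', one_smul] at hz'
          rw [indicator_of_mem hz, hY, indicator_of_mem (show (ξ, s) ∈ _ by
            simp only [mem_ofPred_eq]; rw [dist_comm]; exact hz'.1.le)]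
          simp only [hns, hΦ]
          rw [← mul_one (ENNReal.ofReal _ * ENNReal.ofReal (c * (1 - s) ^ m)⁻¹), mul_comm]
          refine mul_le_mul' ?_ ?_
          · rw [← ENNReal.ofReal_mul (Real.rpow_nonneg (le_min hX0 (by positivity)) _)]
            refine ENNReal.ofReal_le_ofReal ?_
            gcongr
            rw [hP, Real.rpow_mul (hU0 _)]
            refine Real.rpow_le_rpow (Real.rpow_nonneg (hU0 _) _) (le_min ?_ ?_) (by positivity)
            · exact Real.rpow_le_rpow (hU0 _) hz'.2 hp.le
            · have := hUB (s • ξ) (by rw [hns]; exact hs.1) (by rw [hns]; exact hs.2)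
              rwa [hns] at this
          · rw [ENNReal.ofReal_le_one]
            exact pow_le_one₀ hs0.le (by linarith)
      _ = ∫⁻ s in Ico (1 / 2) ρ, (∫⁻ ξ, Y (ξ, s) ∂(polarSphere (m + 1))) :=
          lintegral_lintegral_swap hYm.aemeasurable
      _ ≤ ∫⁻ s in Ico (1 / 2) ρ, ENNReal.ofReal (C / c) * Φ (1 - s) := by
          refine setLIntegral_mono' measurableSet_Ico fun s hs => ?_
          have hs1 : 0 < 1 - s := by linarith [hs.2]
          have e : (fun ξ => Y (ξ, s)) = (closedBall ω (1 - s)).indicator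
              fun _ => Φ (1 - s) * ENNReal.ofReal ((c * (1 - s) ^ m)⁻¹) := by
            ext ξ
            simp [hY, indicator]
          rw [e, lintegral_indicator_const isClosed_closedBall.measurableSet]
          calc _ ≤ Φ (1 - s) * ENNReal.ofReal ((c * (1 - s) ^ m)⁻¹) *
                ENNReal.ofReal (C * (1 - s) ^ m) := by
                gcongr
                exact hcap ω hω _ hs1 (by linarith [hs.1])
            _ = _ := by
                rw [mul_assoc, ← ENNReal.ofReal_mul (by positivity), mul_comm]
                congr 2
                field_simp
      _ = ENNReal.ofReal (C / c) * ∫⁻ s in Ico (1 / 2) ρ, Φ (1 - s) :=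
          lintegral_const_mul' _ _ ENNReal.ofReal_ne_top
      _ ≤ ENNReal.ofReal (C / c) * ∫⁻ t in Ioi (0 : ℝ), Φ t := by
          refine mul_le_mul_right ?_ _
          rw [← lintegral_indicator measurableSet_Ico, ← lintegral_indicator measurableSet_Ioi,
            ← lintegral_sub_left_eq_self ((Ioi (0 : ℝ)).indicator Φ) 1]
          refine lintegral_mono fun s => ?_
          by_cases hs : s ∈ Ico (1 / 2) ρ
          · rw [indicator_of_mem hs, indicator_of_mem (show 1 - s ∈ Ioi (0 : ℝ) from
              sub_pos.2 (hs.2.trans_le hρ))]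
          · rw [indicator_of_notMem hs]
            exact zero_le
      _ ≤ ENNReal.ofReal (C / c) * ENNReal.ofReal (2 * B ^ (1 / (m : ℝ)) * X) := by
          gcongr
          exact lintegral_min_inv_pow_rpow_le hm hB hX0
      _ = _ := by
          rw [ENNReal.ofReal_mul (by positivity : 0 ≤ 2 * B ^ (1 / (m : ℝ))),
            ENNReal.ofReal_mul (by positivity : 0 ≤ C / c), mul_assoc]
  calc _ ≤ ∫⁻ x in sector (1 / 2) ρ (univ : Set (Vec (m + 1))),
          (∫⁻ ω, Z (x, ω) ∂(polarSphere (m + 1))) := setLIntegral_mono' hAm step1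
    _ = ∫⁻ ω, (∫⁻ x in sector (1 / 2) ρ (univ : Set (Vec (m + 1))), Z (x, ω))
          ∂(polarSphere (m + 1)) := lintegral_lintegral_swap hZm.aemeasurable
    _ ≤ ∫⁻ ω, ENNReal.ofReal (C / c * (2 * B ^ (1 / (m : ℝ)))) * ENNReal.ofReal (W ω ^ p)
          ∂(polarSphere (m + 1)) := by
        refine lintegral_mono_ae ?_
        filter_upwards [ae_mem_unitSphere (m + 1)] with ω hω using step2 ω hω
    _ = _ := lintegral_const_mul' _ _ ENNReal.ofReal_ne_top

/-- Pointwise growth of `f` coming from a lower bound on shadows and bounded `L^p` means. -/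
lemma rpow_le_of_le_polarSphere_shadow {n : ℕ} {p c M : ℝ} (hp : 0 < p) (hc : 0 < c)
    {W : Vec n → ℝ} {v : ℝ} (hv : 0 ≤ v) (hM0 : 0 ≤ M)
    (hM : ∫⁻ ω, ENNReal.ofReal (W ω ^ p) ∂(polarSphere n) ≤ ENNReal.ofReal M)
    (hW : Measurable W) {B : Set (Vec n)} {d : ℝ} (hd : 0 < d)
    (h : ENNReal.ofReal (c * d) ≤ polarSphere n {ω ∈ B | v ≤ W ω}) :
    v ^ p ≤ M / c * d⁻¹ := by
  have h1 : ENNReal.ofReal (v ^ p) * ENNReal.ofReal (c * d) ≤ ENNReal.ofReal M := by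
    refine le_trans ?_ ((mul_meas_ge_le_lintegral (hW.pow_const p).ennreal_ofReal
      (ENNReal.ofReal (v ^ p))).trans hM)
    gcongr
    refine h.trans (measure_mono fun ω hω => ?_)
    exact ENNReal.ofReal_le_ofReal (Real.rpow_le_rpow hv hω.2 hp.le)
  rw [← ENNReal.ofReal_mul (by positivity), ENNReal.ofReal_le_ofReal_iff hM0] at h1
  rw [← div_eq_mul_inv, div_div, le_div_iff₀ (by positivity)]
  exact h1

lemma setLIntegral_half_ball_lt_top {n : ℕ} {f : Vec n → Vec n}
    (hf : ContinuousOn f (unitBall n)) {P : ℝ} (hP : 0 ≤ P) :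
    ∫⁻ x in closedBall (0 : Vec n) (1 / 2), ENNReal.ofReal (‖f x‖ ^ P) < ⊤ := by
  have hsub : closedBall (0 : Vec n) (1 / 2) ⊆ unitBall n := closedBall_subset_ball (by norm_num)
  obtain ⟨b, hb⟩ := (isCompact_closedBall (0 : Vec n) (1 / 2)).exists_bound_of_continuousOn
    (hf.mono hsub)
  calc _ ≤ ∫⁻ x in closedBall (0 : Vec n) (1 / 2), ENNReal.ofReal (b ^ P) := by
        refine setLIntegral_mono' isClosed_closedBall.measurableSet fun x hx => ?_
        exact ENNReal.ofReal_le_ofReal (Real.rpow_le_rpow (norm_nonneg _) (hb x hx) hP)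
    _ < ⊤ := by
        rw [setLIntegral_const]
        exact ENNReal.mul_lt_top ENNReal.ofReal_lt_top measure_closedBall_lt_top

theorem hp_to_bergman (n : ℕ) (hn : 2 ≤ n) (K C₀ α a C₁ p : ℝ)
    (hK : 1 ≤ K) (hC₀ : 1 ≤ C₀) (hα : 0 < α) (ha0 : 0 ≤ a) (ha : a < (n : ℝ) - 1)
    (hC₁ : 0 < C₁) (hp : 0 < p)
    (f : Vec n → Vec n) (hf : IsQR n K f) (hf0 : ∀ x ∈ unitBall n, f x ≠ 0)
    (hMin : InMiniowitz n C₀ α f) (hM : MultCond n a C₁ f) (hHp : MemHp n p f) :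
    ∫⁻ x in unitBall n,
      ENNReal.ofReal (‖f x‖ ^ (p * (n : ℝ) / ((n : ℝ) - 1))) < ⊤ := by
  obtain ⟨c, ε, hc, hε, hshadow⟩ :=
    exists_le_polarSphere_shadow hn hK hC₀ hα ha0 ha hC₁ hf hf0 hMin hM
  obtain ⟨C, hC, hcap⟩ := exists_polarSphere_closedBall_le hn
  obtain ⟨M, hM0, hmean⟩ := exists_lintegral_polarSphere_le_of_memHp hn hp hHp
  obtain ⟨m, rfl⟩ : ∃ m, n = m + 1 := ⟨n - 1, by omega⟩
  have hm : 1 ≤ m := by omega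
  have hm0 : (0 : ℝ) < m := by exact_mod_cast hm
  have hfc := hf.1
  have hP : p * ((m + 1 : ℕ) : ℝ) / (((m + 1 : ℕ) : ℝ) - 1) = p * (1 + 1 / (m : ℝ)) := by
    push_cast
    rw [add_sub_cancel_right]
    field_simp
  rw [hP]
  simp only [Nat.add_sub_cancel] at hshadow hcap
  set U : Vec (m + 1) → ℝ := (unitBall (m + 1)).indicator fun y => ‖f y‖ with hUdef
  have hUm : Measurable U := measurable_indicator_norm hfc
  have hUball : ∀ x : Vec (m + 1), ‖x‖ < 1 → U x = ‖f x‖ := fun x hx =>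
    indicator_of_mem (by simpa [unitBall] using hx) _
  have hU0 : ∀ x, 0 ≤ U x := fun x => indicator_nonneg (fun y _ => norm_nonneg (f y)) x
  have hUsphere : ∀ ρ : ℝ, 0 < ρ → ρ < 1 → ∀ ω ∈ unitSphere (m + 1), U (ρ • ω) = ‖f (ρ • ω)‖ := by
    intro ρ hρ0 hρ1 ω hω
    refine hUball _ ?_
    rw [norm_smul, show ‖ω‖ = 1 by simpa [unitSphere] using hω, mul_one,
      Real.norm_of_nonneg hρ0.le]
    exact hρ1
  have hmeanU : ∀ ρ : ℝ, 0 < ρ → ρ < 1 →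
      ∫⁻ ω, ENNReal.ofReal (U (ρ • ω) ^ p) ∂(polarSphere (m + 1)) ≤ ENNReal.ofReal M := by
    intro ρ hρ0 hρ1
    refine le_trans (lintegral_mono_ae ?_) (hmean ρ ⟨hρ0, hρ1⟩)
    filter_upwards [ae_mem_unitSphere (m + 1)] with ω hω
    rw [hUsphere ρ hρ0 hρ1 ω hω]
  have hshadowU : ∀ ρ : ℝ, ρ < 1 → ∀ x : Vec (m + 1), 1 / 2 ≤ ‖x‖ → ‖x‖ ≤ ρ →
      ENNReal.ofReal (c * (1 - ‖x‖) ^ m) ≤ polarSphere (m + 1)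
        {ω ∈ ball (‖x‖⁻¹ • x) (1 - ‖x‖) | ε * U x ≤ U (ρ • ω)} := by
    intro ρ hρ1 x hx2 hxρ
    refine (hshadow ρ hρ1 x hx2 hxρ).trans (measure_mono_ae ?_)
    filter_upwards [ae_mem_unitSphere (m + 1)] with ω hω h
    refine ⟨h.1, ?_⟩
    rw [hUball x (hxρ.trans_lt hρ1), hUsphere ρ (by linarith) hρ1 ω hω]
    exact h.2
  have hgrowth : ∀ x : Vec (m + 1), 1 / 2 ≤ ‖x‖ → ‖x‖ < 1 →
      (ε * U x) ^ p ≤ M / c * ((1 - ‖x‖) ^ m)⁻¹ := fun x hx2 hx1 =>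
    rpow_le_of_le_polarSphere_shadow hp hc (mul_nonneg hε.le (hU0 x)) hM0.le
      (hmeanU ‖x‖ (by linarith) hx1) (hUm.comp (by fun_prop))
      (pow_pos (by linarith) m) (hshadowU ‖x‖ hx1 x hx2 le_rfl)
  set Q : ℝ≥0∞ := ENNReal.ofReal (C / c * (2 * (M / c) ^ (1 / (m : ℝ)))) * ENNReal.ofReal M with hQ
  have hshell : ∀ ρ : ℝ, 0 < ρ → ρ < 1 →
      ∫⁻ x in sector (1 / 2) ρ (univ : Set (Vec (m + 1))),
        ENNReal.ofReal ((ε * U x) ^ (p * (1 + 1 / (m : ℝ)))) ≤ Q := by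
    intro ρ hρ0 hρ1
    refine (lintegral_sector_rpow_le_of_shadow hm hp hc hC (by positivity : 0 < M / c) hρ1.le hcap
      (hUm.const_mul ε) (W := fun ω => U (ρ • ω)) (hUm.comp (by fun_prop))
      (fun x => mul_nonneg hε.le (hU0 x)) (fun ω => hU0 _)
      (fun x hx2 hxρ => hgrowth x hx2 (hxρ.trans hρ1))
      (fun x hx2 hxρ => hshadowU ρ hρ1 x hx2 hxρ.le)).trans ?_
    exact mul_le_mul_right (hmeanU ρ hρ0 hρ1) _
  set ρ : ℕ → ℝ := fun k => 1 - 1 / ((k : ℝ) + 2) with hρ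
  have hρ0 : ∀ k, 0 < ρ k := fun k => by
    have hk : (0 : ℝ) ≤ k := k.cast_nonneg
    have : 1 / ((k : ℝ) + 2) < 1 := (div_lt_one (by positivity)).2 (by linarith)
    simp only [hρ]
    linarith
  have hρ1 : ∀ k, ρ k < 1 := fun k => by
    have : 0 < 1 / ((k : ℝ) + 2) := by positivity
    simp only [hρ]
    linarith
  have hρmono : Monotone ρ := fun i j hij => by
    simp only [hρ]
    gcongr
  have hunion : ∫⁻ x in ⋃ k, sector (1 / 2) (ρ k) (univ : Set (Vec (m + 1))),
      ENNReal.ofReal ((ε * U x) ^ (p * (1 + 1 / (m : ℝ)))) ≤ Q := by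
    rw [setLIntegral_iUnion_of_directed]
    · exact iSup_le fun k => hshell _ (hρ0 k) (hρ1 k)
    · refine Monotone.directed_le fun i j hij x hx => ?_
      exact ⟨⟨hx.1.1, hx.1.2.trans_le (hρmono hij)⟩, hx.2⟩
  have hcover : unitBall (m + 1) ⊆ closedBall 0 (1 / 2) ∪
      ⋃ k, sector (1 / 2) (ρ k) (univ : Set (Vec (m + 1))) := by
    intro x hx
    have hx1 : ‖x‖ < 1 := by simpa [unitBall] using hx
    rcases le_total ‖x‖ (1 / 2) with h | h
    · exact Or.inl (by simpa using h)
    · obtain ⟨k, hk⟩ := exists_nat_one_div_lt (sub_pos.2 hx1)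
      refine Or.inr (mem_iUnion.2 ⟨k, ⟨h, ?_⟩, mem_univ _⟩)
      have : 1 / ((k : ℝ) + 2) ≤ 1 / ((k : ℝ) + 1) := by gcongr; norm_num
      simp only [hρ]
      linarith
  have hscale : ∀ x ∈ ⋃ k, sector (1 / 2) (ρ k) (univ : Set (Vec (m + 1))),
      ENNReal.ofReal (‖f x‖ ^ (p * (1 + 1 / (m : ℝ)))) =
        ENNReal.ofReal (ε⁻¹ ^ (p * (1 + 1 / (m : ℝ)))) *
          ENNReal.ofReal ((ε * U x) ^ (p * (1 + 1 / (m : ℝ)))) := by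
    intro x hx
    obtain ⟨k, hk⟩ := mem_iUnion.1 hx
    rw [hUball x (hk.1.2.trans (hρ1 k)), ← ENNReal.ofReal_mul (by positivity),
      ← Real.mul_rpow (by positivity) (by positivity), inv_mul_cancel_left₀ hε.ne']
  calc _ ≤ _ := lintegral_mono_set hcover
    _ ≤ _ := lintegral_union_le _ _ _
    _ < ⊤ := by
        refine ENNReal.add_lt_top.2 ⟨setLIntegral_half_ball_lt_top hfc (by positivity), ?_⟩
        rw [setLIntegral_congr_fun (MeasurableSet.iUnion fun k =>
          measurableSet_sector _ _ MeasurableSet.univ) hscale,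
          lintegral_const_mul' _ _ ENNReal.ofReal_ne_top]
        refine ENNReal.mul_lt_top ENNReal.ofReal_lt_top (hunion.trans_lt ?_)
        exact ENNReal.mul_lt_top ENNReal.ofReal_lt_top ENNReal.ofReal_lt_top

end
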